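/- arXiv:1012.0936 — 2 statements merged into one kernel-verified Lean document; each statement's English description precedes it below -/
import Mathlib

section
/- Suppose X satisfies Assumption 1, and let T : (0, ∞) → (0, ∞) satisfy T_u/u → 0 as u → ∞ (T_u = o(u)). Then P(Q_e + Y̲(T_u) > u) ∼ (1/(α − 1)) · u · P(X(1) > u) as u → ∞, i.e. the ratio of the two sides converges to 1. -/
open MeasureTheory ProbabilityTheory Filter Set


lemma potter_aux (F : ℝ → ℝ) (hF : Antitone F) (hpos : ∀ x, 0 < F x) (α : ℝ) (hα : 1 < α)
    (hRV : ∀ c : ℝ, 0 < c → Tendsto (fun x => F (c * x) / F x) atTop (nhds (c ^ (-α)))) :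
    ∃ β : ℝ, 1 < β ∧ ∃ x0 : ℝ, 0 < x0 ∧ ∀ x, x0 ≤ x → ∀ s, 1 ≤ s →
      F (s * x) / F x ≤ 2 ^ β * s ^ (-β) := by
  refine ⟨(1 + α) / 2, by linarith, ?_⟩
  set β := (1 + α) / 2 with hβ
  have h1 : (2:ℝ) ^ (-α) < 2 ^ (-β) :=
    Real.rpow_lt_rpow_of_exponent_lt (by norm_num) (by linarith)
  have h2 := (hRV 2 (by norm_num)).eventually (gt_mem_nhds h1)
  obtain ⟨x1, hx1⟩ := eventually_atTop.1 h2
  refine ⟨max x1 1, by positivity, fun x hx s hs => ?_⟩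
  have hx1' : x1 ≤ x := le_trans (le_max_left _ _) hx
  have hx0 : 1 ≤ x := le_trans (le_max_right _ _) hx
  have key : ∀ k : ℕ, F (2 ^ k * x) ≤ ((2:ℝ) ^ (-β)) ^ k * F x := by
    intro k
    induction k with
    | zero => simp
    | succ k ih =>
      have hk : x1 ≤ 2 ^ k * x := by
        have : (1:ℝ) ≤ 2 ^ k := one_le_pow₀ (by norm_num)
        nlinarith
      have h3 := (hx1 _ hk).le
      rw [div_le_iff₀ (hpos _)] at h3
      calc F (2 ^ (k+1) * x) = F (2 * (2 ^ k * x)) := by ring_nf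
        _ ≤ 2 ^ (-β) * F (2 ^ k * x) := h3
        _ ≤ 2 ^ (-β) * (((2:ℝ) ^ (-β)) ^ k * F x) := by gcongr
        _ = _ := by ring
  obtain ⟨k, hk1, hk2⟩ := exists_nat_pow_near hs (by norm_num : (1:ℝ) < 2)
  rw [div_le_iff₀ (hpos _)]
  have h4 : F (s * x) ≤ F (2 ^ k * x) := hF (by gcongr)
  have h5 : ((2:ℝ) ^ (-β)) ^ k = 2 ^ β * ((2:ℝ) ^ (k+1)) ^ (-β) := by
    rw [← Real.rpow_natCast, ← Real.rpow_natCast, ← Real.rpow_mul (by norm_num),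
      ← Real.rpow_mul (by norm_num), ← Real.rpow_add (by norm_num)]
    congr 1; push_cast; ring
  have h6 : ((2:ℝ) ^ (k+1)) ^ (-β) ≤ s ^ (-β) :=
    Real.rpow_le_rpow_of_nonpos (by linarith) hk2.le (by rw [hβ]; linarith)
  calc F (s * x) ≤ _ := h4
    _ ≤ _ := key k
    _ = 2 ^ β * ((2:ℝ) ^ (k+1)) ^ (-β) * F x := by rw [h5]
    _ ≤ _ := by gcongr; exact (hpos x).le

lemma karamata_aux (F : ℝ → ℝ) (hF : Antitone F) (hpos : ∀ x, 0 < F x) (α : ℝ) (hα : 1 < α)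
    (hRV : ∀ c : ℝ, 0 < c → Tendsto (fun x => F (c * x) / F x) atTop (nhds (c ^ (-α)))) :
    Tendsto (fun x => (∫ t in Ioi x, F t) / ((1 / (α - 1)) * x * F x)) atTop (nhds 1) := by
  obtain ⟨β, hβ, x0, hx0, hb⟩ := potter_aux F hF hpos α hα hRV
  have hlim : Tendsto (fun x => ∫ s in Ioi (1:ℝ), F (x * s) / F x) atTop
      (nhds (∫ s in Ioi (1:ℝ), s ^ (-α))) := by
    apply tendsto_integral_filter_of_dominated_convergence (fun s => 2 ^ β * s ^ (-β))
    · filter_upwards with x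
      exact ((hF.measurable.comp (measurable_const_mul x)).div_const _).aestronglyMeasurable
    · filter_upwards [eventually_ge_atTop x0] with x hx
      filter_upwards [ae_restrict_mem measurableSet_Ioi] with s hs
      rw [Real.norm_of_nonneg (div_nonneg (hpos _).le (hpos _).le), mul_comm x s]
      exact hb x hx s (le_of_lt hs)
    · exact ((integrableOn_Ioi_rpow_of_lt (by linarith) (by norm_num))).const_mul _
    · filter_upwards [ae_restrict_mem measurableSet_Ioi] with s hs
      simp_rw [mul_comm _ s]
      exact hRV s (lt_trans one_pos hs)
  rw [integral_Ioi_rpow_of_lt (by linarith) (by norm_num)] at hlim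
  have h2 := hlim.mul_const (α - 1)
  have h3 : -(1:ℝ) ^ (-α + 1) / (-α + 1) * (α - 1) = 1 := by
    rw [Real.one_rpow]
    have : -α + 1 ≠ 0 := by linarith
    field_simp; ring
  rw [h3] at h2
  refine h2.congr' ?_
  filter_upwards [eventually_gt_atTop 0] with x hx
  have h4 := integral_comp_mul_left_Ioi F 1 hx
  rw [integral_div, h4]
  have := hpos x
  have : α - 1 ≠ 0 := by linarith
  simp only [smul_eq_mul, mul_one]
  field_simp

lemma Hratio_aux (F : ℝ → ℝ) (hF : Antitone F) (hpos : ∀ x, 0 < F x) (α : ℝ) (hα : 1 < α)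
    (hRV : ∀ c : ℝ, 0 < c → Tendsto (fun x => F (c * x) / F x) atTop (nhds (c ^ (-α))))
    (c : ℝ) (hc : 0 < c) :
    Tendsto (fun x => (∫ t in Ioi (c * x), F t) / (∫ t in Ioi x, F t)) atTop
      (nhds (c ^ (1 - α))) := by
  have h := karamata_aux F hF hpos α hα hRV
  have h1 : Tendsto (fun x : ℝ => c * x) atTop atTop := tendsto_id.const_mul_atTop hc
  have h2 := ((h.comp h1).mul ((hRV c hc).const_mul c)).div h one_ne_zero
  have e : 1 * (c * c ^ (-α)) / 1 = c ^ (1 - α) := by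
    rw [Real.rpow_sub hc, Real.rpow_one, Real.rpow_neg hc.le]; field_simp
  rw [e] at h2
  refine h2.congr' ?_
  filter_upwards [eventually_gt_atTop 0] with x hx
  have := hpos x
  have := hpos (c * x)
  have : α - 1 ≠ 0 := by linarith
  simp only [Function.comp, Pi.div_apply, Pi.mul_apply]
  field_simp

/-- iteration -/
lemma iter_aux (p H : ℝ → ℝ) (hp1 : ∀ x, p x ≤ 1) (hp0 : ∀ x, 0 ≤ p x) (hH : Antitone H)
    (hpos : ∀ x, 0 < H x) (γ : ℝ)
    (hR : ∀ c : ℝ, 0 < c → Tendsto (fun x => H (c * x) / H x) atTop (nhds (c ^ γ)))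
    (hrec : ∀ r, 0 < r → r < 1 → ∀ κ > 0, ∀ᶠ v in atTop,
      p v * (1 - κ) ≤ H (r ^ 2 * v) + κ * p (r * (1 - r) * v)) :
    ∀ ε > 0, ∀ᶠ v in atTop, p v ≤ (1 + ε) * H v := by
  have hbdd : ∃ B > 0, ∀ᶠ v in atTop, p v ≤ B * H v := by
    set D : ℝ := (1/4 : ℝ) ^ γ + 1 with hD
    have hD1 : 1 ≤ D := by
      have : 0 ≤ (1/4 : ℝ) ^ γ := by positivity
      linarith
    have e1 := (hR (1/4) (by norm_num)).eventually (gt_mem_nhds (show (1/4 : ℝ) ^ γ < D by linarith))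
    have e2 := hrec (1/2) (by norm_num) (by norm_num) (1 / (4 * D)) (by positivity)
    obtain ⟨v0, hv0⟩ := eventually_atTop.1 ((e1.and e2).and (eventually_ge_atTop 1))
    have hv01 : 1 ≤ v0 := (hv0 v0 le_rfl).2
    set B := max (4 * D) (1 / H v0) with hB
    have hBD : 4 * D ≤ B := le_max_left _ _
    have hB1 : 1 ≤ B * H v0 := by
      have : 1 / H v0 ≤ B := le_max_right _ _
      rwa [div_le_iff₀ (hpos _)] at this
    refine ⟨B, by linarith, ?_⟩
    have key : ∀ n : ℕ, ∀ v, v ≤ 4 ^ n * v0 → p v ≤ B * H v := by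
      intro n
      induction n with
      | zero =>
        intro v hv
        have hv' : v ≤ v0 := by simpa using hv
        have : B * H v0 ≤ B * H v := by
          have := hH hv'
          have : 0 ≤ B := by linarith
          gcongr
        linarith [hp1 v]
      | succ n ih =>
        intro v hv
        by_cases hvv : v ≤ v0
        · have : B * H v0 ≤ B * H v := by
            have := hH hvv
            have : 0 ≤ B := by linarith
            gcongr
          linarith [hp1 v]
        · push Not at hvv
          obtain ⟨⟨a1, a2⟩, a3⟩ := hv0 v hvv.le
          rw [div_lt_iff₀ (hpos _)] at a1
          have i1 := ih (1/4 * v) (by rw [pow_succ] at hv; linarith)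
          have e3 : ((1:ℝ)/2)^2 * v = 1/4 * v := by ring
          have e4 : ((1:ℝ)/2) * (1 - 1/2) * v = 1/4 * v := by ring
          rw [e3, e4] at a2
          have hκ : 1 / (4 * D) ≤ 1/2 := by
            rw [div_le_div_iff₀ (by positivity) (by norm_num)]; linarith
          have b1 : p v * (1/2) ≤ p v * (1 - 1 / (4 * D)) := by
            have := hp0 v
            gcongr; linarith
          have b2 : 1 / (4 * D) * p (1/4 * v) ≤ 1 / (4 * D) * (B * (D * H v)) := by
            gcongr
            refine i1.trans ?_
            have : 0 ≤ B := by linarith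
            gcongr
          have b3 : 1 / (4 * D) * (B * (D * H v)) = B / 4 * H v := by field_simp
          have b4 : 4 * D * H v ≤ B * H v := by
            have := hpos v
            gcongr
          nlinarith
    filter_upwards with v
    obtain ⟨n, hn⟩ := pow_unbounded_of_one_lt v (by norm_num : (1:ℝ) < 4)
    exact key n v (by nlinarith [pow_pos (show (0:ℝ) < 4 by norm_num) n])
  obtain ⟨B, hB, hbd⟩ := hbdd
  intro ε hε
  -- choose r
  have hr : ∃ r : ℝ, 0 < r ∧ r < 1 ∧ (r ^ 2) ^ γ < 1 + ε / 4 := by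
    have hc : ContinuousAt (fun r : ℝ => (r ^ 2) ^ γ) 1 := by
      apply ContinuousAt.rpow_const
      · fun_prop
      · left; norm_num
    have h1 : ∀ᶠ r in nhds (1:ℝ), (r ^ 2) ^ γ < 1 + ε / 4 :=
      hc.eventually (gt_mem_nhds (by simp; linarith))
    have h2 : ∀ᶠ r in nhdsWithin (1:ℝ) (Iio 1), (r ^ 2) ^ γ < 1 + ε / 4 :=
      h1.filter_mono nhdsWithin_le_nhds
    have h3 : ∀ᶠ r in nhdsWithin (1:ℝ) (Iio 1), (0:ℝ) < r :=
      (lt_mem_nhds (show (0:ℝ) < 1 by norm_num)).filter_mono nhdsWithin_le_nhds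
    obtain ⟨r, ⟨a, b⟩, c⟩ := ((h2.and h3).and self_mem_nhdsWithin).exists
    exact ⟨r, b, c, a⟩
  obtain ⟨r, hr0, hr1, hr2⟩ := hr
  have hcpos : 0 < r * (1 - r) := by nlinarith
  set c := r * (1 - r) with hc
  set D : ℝ := c ^ γ + 1 with hD
  have hD1 : 1 ≤ D := by
    have : 0 ≤ c ^ γ := by positivity
    linarith
  -- κ
  obtain ⟨κ, hκ0, hκ1, hκ2⟩ : ∃ κ > 0, κ * (B * D) ≤ ε / 4 ∧ κ * (1 + ε) ≤ ε / 4 := by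
    refine ⟨min (ε / 4 / (B * D)) (ε / 4 / (1 + ε)), by positivity, ?_, ?_⟩
    · rw [← le_div_iff₀ (by positivity)]; exact min_le_left _ _
    · rw [← le_div_iff₀ (by positivity)]; exact min_le_right _ _
  have e1 := (hR (r^2) (by positivity)).eventually (gt_mem_nhds hr2)
  have e2 := (hR c hcpos).eventually (gt_mem_nhds (show c ^ γ < D by linarith))
  have e3 := (tendsto_id.const_mul_atTop hcpos).eventually hbd
  filter_upwards [e1, e2, e3, hrec r hr0 hr1 κ hκ0] with v a1 a2 a3 a4
  rw [div_lt_iff₀ (hpos _)] at a1 a2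
  simp only [id] at a3
  have := hpos v
  have b1 : κ * p (c * v) ≤ κ * (B * (D * H v)) := by
    gcongr
    exact a3.trans (by gcongr)
  have b2 : κ * (B * (D * H v)) ≤ ε / 4 * H v := by
    calc _ = κ * (B * D) * H v := by ring
      _ ≤ _ := by gcongr
  have b3 : p v * (1 - κ) ≤ (1 + ε / 2) * H v := by linarith
  have hκ3 : κ < 1 := by nlinarith
  have b4 : (1 + ε / 2) * H v ≤ (1 + ε) * H v * (1 - κ) := by
    have : 1 + ε / 2 ≤ (1 + ε) * (1 - κ) := by linarith
    calc _ ≤ (1 + ε) * (1 - κ) * H v := by gcongr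
      _ = _ := by ring
  exact le_of_mul_le_mul_right (b3.trans b4) (by linarith)


noncomputable def HH (μ : Measure ℝ) (y : ℝ) : ℝ := ∫ x, max (x - y) 0 ∂μ
noncomputable def GG (μ : Measure ℝ) (y : ℝ) : ℝ := ∫ x, max (-x - y) 0 ∂μ
noncomputable def KK (μ : Measure ℝ) (z : ℝ) : ℝ := ∫ x, (max (z + x) 0 - max z 0) ∂μ

section core
variable {μ ν : Measure ℝ}

lemma HH_int [IsProbabilityMeasure μ] (hint : Integrable (fun x : ℝ => x) μ) (y : ℝ) :
    Integrable (fun x => max (x - y) 0) μ :=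
  (hint.sub (integrable_const y)).pos_part

lemma GG_int [IsProbabilityMeasure μ] (hint : Integrable (fun x : ℝ => x) μ) (y : ℝ) :
    Integrable (fun x => max (-x - y) 0) μ :=
  (hint.neg.sub (integrable_const y)).pos_part

lemma HH_anti [IsProbabilityMeasure μ] (hint : Integrable (fun x : ℝ => x) μ) :
    Antitone (HH μ) := fun a b hab =>
  integral_mono (HH_int hint b) (HH_int hint a) fun x => max_le_max (by linarith) le_rfl

lemma GG_anti [IsProbabilityMeasure μ] (hint : Integrable (fun x : ℝ => x) μ) :
    Antitone (GG μ) := fun a b hab =>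
  integral_mono (GG_int hint b) (GG_int hint a) fun x => max_le_max (by linarith) le_rfl

lemma HH_nonneg (y : ℝ) : 0 ≤ HH μ y := integral_nonneg fun _ => le_max_right _ _
lemma GG_nonneg (y : ℝ) : 0 ≤ GG μ y := integral_nonneg fun _ => le_max_right _ _

lemma HH_le [IsProbabilityMeasure μ] (hint : Integrable (fun x : ℝ => x) μ) (y : ℝ) (hy : 0 ≤ y) :
    HH μ y ≤ ∫ x, |x| ∂μ :=
  integral_mono (HH_int hint y) hint.abs fun x =>
    max_le (by linarith [le_abs_self x]) (abs_nonneg x)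

lemma GG_le [IsProbabilityMeasure μ] (hint : Integrable (fun x : ℝ => x) μ) (y : ℝ) (hy : 0 ≤ y) :
    GG μ y ≤ ∫ x, |x| ∂μ :=
  integral_mono (GG_int hint y) hint.abs fun x =>
    max_le (by linarith [neg_abs_le x]) (abs_nonneg x)

lemma HH_tendsto [IsProbabilityMeasure μ] (hint : Integrable (fun x : ℝ => x) μ) :
    Tendsto (HH μ) atTop (nhds 0) := by
  have : Tendsto (HH μ) atTop (nhds (∫ x, (0:ℝ) ∂μ)) := by
    apply tendsto_integral_filter_of_dominated_convergence (fun x => |x|)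
    · filter_upwards with y
      exact (HH_int hint y).aestronglyMeasurable
    · filter_upwards [eventually_ge_atTop 0] with y hy
      filter_upwards with x
      rw [Real.norm_of_nonneg (le_max_right _ _)]
      exact max_le (by linarith [le_abs_self x]) (abs_nonneg x)
    · exact hint.abs
    · filter_upwards with x
      apply tendsto_const_nhds.congr'
      filter_upwards [eventually_ge_atTop x] with y hy
      rw [max_eq_right (by linarith)]
  simpa using this

lemma GG_tendsto [IsProbabilityMeasure μ] (hint : Integrable (fun x : ℝ => x) μ) :
    Tendsto (GG μ) atTop (nhds 0) := by
  have : Tendsto (GG μ) atTop (nhds (∫ x, (0:ℝ) ∂μ)) := by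
    apply tendsto_integral_filter_of_dominated_convergence (fun x => |x|)
    · filter_upwards with y
      exact (GG_int hint y).aestronglyMeasurable
    · filter_upwards [eventually_ge_atTop 0] with y hy
      filter_upwards with x
      rw [Real.norm_of_nonneg (le_max_right _ _)]
      exact max_le (by linarith [neg_abs_le x]) (abs_nonneg x)
    · exact hint.abs
    · filter_upwards with x
      apply tendsto_const_nhds.congr'
      filter_upwards [eventually_ge_atTop (-x)] with y hy
      rw [max_eq_right (by linarith)]
  simpa using this

lemma KK_nonpos (z : ℝ) (hz : z ≤ 0) : KK μ z = HH μ (-z) := by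
  unfold KK HH
  congr 1; ext x
  rw [max_eq_right hz]; ring_nf

lemma KK_pos [IsProbabilityMeasure μ] (hint : Integrable (fun x : ℝ => x) μ)
    (hmean : ∫ x, x ∂μ = -1) (z : ℝ) (hz : 0 ≤ z) : KK μ z = -1 + GG μ z := by
  unfold KK GG
  rw [← hmean, ← integral_add hint (GG_int hint z)]
  congr 1; ext x
  rw [max_eq_left hz]
  rcases le_total 0 (z + x) with h | h
  · rw [max_eq_left h, max_eq_right (by linarith)]; ring
  · rw [max_eq_right h, max_eq_left (by linarith)]; ring

lemma core_id [IsProbabilityMeasure μ] [IsProbabilityMeasure ν]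
    (hint : Integrable (fun x : ℝ => x) μ)
    (hfix : ν = (ν.prod μ).map (fun z => max 0 (z.1 + z.2))) (u : ℝ) (hu : 0 ≤ u) :
    Integrable (fun z : ℝ × ℝ => max (z.1 - u + z.2) 0 - max (z.1 - u) 0) (ν.prod μ) ∧
    ∫ z, (max (z.1 - u + z.2) 0 - max (z.1 - u) 0) ∂(ν.prod μ) = 0 := by
  have hdom : Integrable (fun z : ℝ × ℝ => |z.2|) (ν.prod μ) :=
    (hint.abs).comp_snd ν
  have hlip : ∀ z : ℝ × ℝ, |max (z.1 - u + z.2) 0 - max (z.1 - u) 0| ≤ |z.2| := by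
    intro z
    have := abs_max_sub_max_le_abs (z.1 - u + z.2) (z.1 - u) 0
    simpa using this
  refine ⟨hdom.mono' (by fun_prop) (ae_of_all _ hlip), ?_⟩
  let φ : ℕ → ℝ → ℝ := fun L z => min (max z 0) L
  have hφm : ∀ L, Measurable (φ L) := fun L => by fun_prop
  have hφb : ∀ L z, |φ L z| ≤ L := by
    intro L z
    have h0 : (0:ℝ) ≤ L := Nat.cast_nonneg L
    rw [abs_of_nonneg (le_min (le_max_right _ _) h0)]
    exact min_le_right _ _
  have hint1 : ∀ L, Integrable (fun z : ℝ × ℝ => φ L (z.1 - u + z.2)) (ν.prod μ) := fun L =>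
    Integrable.of_bound (((hφm L).comp (by fun_prop)).aestronglyMeasurable) L
      (ae_of_all _ fun z => hφb L _)
  have hint2 : ∀ L, Integrable (fun z : ℝ × ℝ => φ L (z.1 - u)) (ν.prod μ) := fun L =>
    Integrable.of_bound (((hφm L).comp (by fun_prop)).aestronglyMeasurable) L
      (ae_of_all _ fun z => hφb L _)
  have hz : ∀ L, ∫ z, (φ L (z.1 - u + z.2) - φ L (z.1 - u)) ∂(ν.prod μ) = 0 := by
    intro L
    rw [integral_sub (hint1 L) (hint2 L)]
    have e1 : ∫ z, φ L (z.1 - u) ∂(ν.prod μ) = ∫ m, φ L (m - u) ∂ν := by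
      have := integral_fun_fst (μ := ν) (ν := μ) (fun m => φ L (m - u))
      simpa using this
    have e2 : ∫ m, φ L (m - u) ∂ν = ∫ z, φ L (z.1 - u + z.2) ∂(ν.prod μ) := by
      conv_lhs => rw [hfix]
      have hm2 : Measurable (fun m : ℝ => φ L (m - u)) := (hφm L).comp (by fun_prop)
      have hm3 : Measurable (fun z : ℝ × ℝ => max 0 (z.1 + z.2)) := by fun_prop
      rw [integral_map hm3.aemeasurable hm2.aestronglyMeasurable]
      congr 1; ext z
      simp only [φ]
      congr 1
      rcases le_total 0 (z.1 + z.2) with h | h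
      · rw [max_eq_right h]; ring_nf
      · rw [max_eq_left h, max_eq_right (by linarith), max_eq_right (by linarith)]
    rw [e1, e2, sub_self]
  have hlim : Tendsto (fun L : ℕ => ∫ z, (φ L (z.1 - u + z.2) - φ L (z.1 - u)) ∂(ν.prod μ)) atTop
      (nhds (∫ z, (max (z.1 - u + z.2) 0 - max (z.1 - u) 0) ∂(ν.prod μ))) := by
    apply tendsto_integral_of_dominated_convergence (fun z => |z.2|)
    · intro L
      exact ((hint1 L).sub (hint2 L)).aestronglyMeasurable
    · exact hdom
    · intro L
      refine ae_of_all _ fun z => ?_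
      refine le_trans ?_ (hlip z)
      have := abs_min_sub_min_le_max (max (z.1 - u + z.2) 0) L (max (z.1 - u) 0) L
      simpa using this
    · refine ae_of_all _ fun z => ?_
      have : ∀ w : ℝ, Tendsto (fun L : ℕ => φ L w) atTop (nhds (max w 0)) := by
        intro w
        apply tendsto_const_nhds.congr'
        obtain ⟨N, hN⟩ := exists_nat_ge (max w 0)
        filter_upwards [eventually_ge_atTop N] with L hL
        have : (N:ℝ) ≤ L := by exact_mod_cast hL
        simp only [φ]
        rw [min_eq_left (by linarith)]
      exact (this _).sub (this _)
  simp_rw [hz] at hlim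
  exact (tendsto_nhds_unique hlim tendsto_const_nhds)

lemma core_KK [IsProbabilityMeasure μ] [IsProbabilityMeasure ν]
    (hint : Integrable (fun x : ℝ => x) μ)
    (hfix : ν = (ν.prod μ).map (fun z => max 0 (z.1 + z.2))) (u : ℝ) (hu : 0 ≤ u) :
    Integrable (fun m => KK μ (m - u) + (Ioi u).indicator 1 m) ν ∧
    ν.real (Ioi u) = ∫ m, (KK μ (m - u) + (Ioi u).indicator 1 m) ∂ν := by
  obtain ⟨h1, h2⟩ := core_id hint hfix u hu
  have h3 : Integrable (fun m => KK μ (m - u)) ν := h1.integral_prod_left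
  have h4 : ∫ m, KK μ (m - u) ∂ν = 0 := by
    rw [← h2, integral_prod _ h1]; rfl
  have h5 : Integrable ((Ioi u).indicator (1 : ℝ → ℝ)) ν :=
    (integrable_const (1:ℝ)).indicator measurableSet_Ioi
  refine ⟨h3.add h5, ?_⟩
  rw [integral_add h3 h5, h4, zero_add, integral_indicator_one measurableSet_Ioi]

lemma core_lower [IsProbabilityMeasure μ] [IsProbabilityMeasure ν]
    (hint : Integrable (fun x : ℝ => x) μ) (hmean : ∫ x, x ∂μ = -1)
    (hfix : ν = (ν.prod μ).map (fun z => max 0 (z.1 + z.2))) (u : ℝ) (hu : 0 ≤ u) :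
    HH μ u * (1 - ν.real (Ioi u)) ≤ ν.real (Ioi u) := by
  obtain ⟨h1, h2⟩ := core_KK hint hfix u hu
  have hnn : ∀ᵐ m ∂ν, 0 ≤ m := by
    rw [hfix, ae_map_iff (by fun_prop) measurableSet_Ici]
    exact ae_of_all _ fun z => le_max_left _ _
  have e : HH μ u * (1 - ν.real (Ioi u)) = ∫ m, HH μ u * (Iic u).indicator 1 m ∂ν := by
    rw [integral_const_mul, integral_indicator_one measurableSet_Iic]
    rw [← compl_Ioi, probReal_compl_eq_one_sub measurableSet_Ioi]
  rw [e]
  conv_rhs => rw [h2]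
  refine integral_mono_ae (((integrable_const (1:ℝ)).indicator measurableSet_Iic).const_mul _) h1 ?_
  filter_upwards [hnn] with m hm
  rcases le_or_gt m u with h | h
  · have : HH μ u ≤ HH μ (u - m) := HH_anti hint (by linarith)
    simp only [indicator, mem_Iic, h, mem_Ioi, if_true, not_lt.2 h, if_false, Pi.one_apply]
    rw [KK_nonpos _ (by linarith), neg_sub]; linarith
  · simp only [indicator, mem_Iic, h, mem_Ioi, if_true, not_le.2 h, if_false, Pi.one_apply]
    rw [KK_pos hint hmean _ (by linarith)]
    linarith [GG_nonneg (μ := μ) (m - u)]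

lemma core_upper [IsProbabilityMeasure μ] [IsProbabilityMeasure ν]
    (hint : Integrable (fun x : ℝ => x) μ) (hmean : ∫ x, x ∂μ = -1)
    (hfix : ν = (ν.prod μ).map (fun z => max 0 (z.1 + z.2))) (u : ℝ) (hu : 0 ≤ u)
    (δ R : ℝ) (hR : 0 ≤ R) :
    ν.real (Ioi u) ≤ HH μ ((1 - δ) * u) + HH μ R * ν.real (Ioi (δ * u))
      + (∫ x, |x| ∂μ) * (ν.real (Ioi (u - R)) - ν.real (Ioi (u + R)))
      + GG μ R * ν.real (Ioi u) := by
  obtain ⟨h1, h2⟩ := core_KK hint hfix u hu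
  set C := ∫ x, |x| ∂μ with hC
  have hC0 : 0 ≤ C := integral_nonneg fun x => abs_nonneg x
  have i1 : ∀ a : ℝ, ∀ S : Set ℝ, MeasurableSet S → Integrable (fun m => a * S.indicator (1 : ℝ → ℝ) m) ν :=
    fun a S hS => ((integrable_const (1:ℝ)).indicator hS).const_mul _
  have j1 : ∀ a : ℝ, ∀ S : Set ℝ, MeasurableSet S → ∫ m, a * S.indicator (1 : ℝ → ℝ) m ∂ν = a * ν.real S :=
    fun a S hS => by rw [integral_const_mul, integral_indicator_one hS]
  have e0 : ν.real (Ioc (u - R) (u + R)) = ν.real (Ioi (u - R)) - ν.real (Ioi (u + R)) := by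
    rw [← Ioi_sdiff_Ioi, measureReal_sdiff (Ioi_subset_Ioi (by linarith)) measurableSet_Ioi]
  have e : HH μ ((1 - δ) * u) + HH μ R * ν.real (Ioi (δ * u))
      + C * (ν.real (Ioi (u - R)) - ν.real (Ioi (u + R)))
      + GG μ R * ν.real (Ioi u) = ∫ m, (HH μ ((1 - δ) * u) + HH μ R * (Ioi (δ * u)).indicator 1 m
        + C * (Ioc (u - R) (u + R)).indicator 1 m + GG μ R * (Ioi u).indicator 1 m) ∂ν := by
    rw [integral_add, integral_add, integral_add, j1 _ _ measurableSet_Ioi, j1 _ _ measurableSet_Ioi,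
      j1 _ _ measurableSet_Ioc, e0]
    · simp
    · exact integrable_const _
    · exact i1 _ _ measurableSet_Ioi
    · exact (integrable_const _).add (i1 _ _ measurableSet_Ioi)
    · exact i1 _ _ measurableSet_Ioc
    · exact ((integrable_const _).add (i1 _ _ measurableSet_Ioi)).add (i1 _ _ measurableSet_Ioc)
    · exact i1 _ _ measurableSet_Ioi
  rw [e]
  conv_lhs => rw [h2]
  refine integral_mono h1 ?_ fun m => ?_
  · exact (((integrable_const _).add (i1 _ _ measurableSet_Ioi)).add (i1 _ _ measurableSet_Ioc)).add
      (i1 _ _ measurableSet_Ioi)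
  have t1 : 0 ≤ HH μ ((1 - δ) * u) := HH_nonneg _
  have ind : ∀ S : Set ℝ, 0 ≤ S.indicator (1 : ℝ → ℝ) m := fun S =>
    indicator_nonneg (fun _ _ => zero_le_one) m
  have t2 : 0 ≤ HH μ R * (Ioi (δ * u)).indicator 1 m := mul_nonneg (HH_nonneg _) (ind _)
  have t3 : 0 ≤ C * (Ioc (u - R) (u + R)).indicator 1 m := mul_nonneg hC0 (ind _)
  have t4 : 0 ≤ GG μ R * (Ioi u).indicator 1 m := mul_nonneg (GG_nonneg _) (ind _)
  show KK μ (m - u) + (Ioi u).indicator 1 m ≤ _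
  rcases le_or_gt m u with h | h
  · have e1 : (Ioi u).indicator (1 : ℝ → ℝ) m = 0 := by simp [h]
    rw [KK_nonpos _ (by linarith), neg_sub, e1, add_zero]
    rw [e1] at t4
    by_cases a : m ≤ δ * u
    · have : HH μ (u - m) ≤ HH μ ((1 - δ) * u) := HH_anti hint (by linarith)
      linarith
    · push Not at a
      by_cases b : m ≤ u - R
      · have : HH μ (u - m) ≤ HH μ R := HH_anti hint (by linarith)
        have e2 : (Ioi (δ * u)).indicator (1 : ℝ → ℝ) m = 1 := by simp [a]
        rw [e2] at t2 ⊢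
        linarith
      · push Not at b
        have := HH_le hint (u - m) (by linarith)
        have e2 : (Ioc (u - R) (u + R)).indicator (1 : ℝ → ℝ) m = 1 := by
          rw [indicator_of_mem]; rfl
          exact ⟨b, by linarith⟩
        rw [e2] at t3 ⊢
        linarith
  · have e1 : (Ioi u).indicator (1 : ℝ → ℝ) m = 1 := by simp [h]
    rw [KK_pos hint hmean _ (by linarith), e1]
    rw [e1] at t4
    by_cases b : m ≤ u + R
    · have := GG_le hint (m - u) (by linarith)
      have e2 : (Ioc (u - R) (u + R)).indicator (1 : ℝ → ℝ) m = 1 := by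
        rw [indicator_of_mem]; rfl
        exact ⟨by linarith, b⟩
      rw [e2] at t3 ⊢
      linarith
    · push Not at b
      have : GG μ (m - u) ≤ GG μ R := GG_anti hint (by linarith)
      linarith

lemma core_rec [IsProbabilityMeasure μ] [IsProbabilityMeasure ν]
    (hint : Integrable (fun x : ℝ => x) μ) (hmean : ∫ x, x ∂μ = -1)
    (hfix : ν = (ν.prod μ).map (fun z => max 0 (z.1 + z.2))) (r : ℝ) (hr0 : 0 < r) (hr1 : r < 1)
    (κ : ℝ) (hκ : 0 < κ) : ∀ᶠ v in atTop,
      ν.real (Ioi v) * (1 - κ) ≤ HH μ (r ^ 2 * v) + κ * ν.real (Ioi (r * (1 - r) * v)) := by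
  set C := ∫ x, |x| ∂μ with hC
  have hC0 : 0 ≤ C := integral_nonneg fun x => abs_nonneg x
  set p : ℝ → ℝ := fun u => ν.real (Ioi u) with hp
  have hpa : Antitone p := fun a b hab => measureReal_mono (Ioi_subset_Ioi hab)
  have hp0 : ∀ x, 0 ≤ p x := fun x => measureReal_nonneg
  obtain ⟨R, ⟨hR1, hR2, hR3⟩, hR0⟩ :=
    ((((HH_tendsto hint).eventually (ge_mem_nhds (half_pos hκ))).and
     (((GG_tendsto hint).eventually (ge_mem_nhds hκ)).and
      ((GG_tendsto hint).eventually (ge_mem_nhds one_pos)))).and (eventually_ge_atTop (0:ℝ))).exists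
  obtain ⟨n, hn⟩ := exists_nat_ge (C / (κ / 2) + 1)
  have hnpos : (0:ℝ) < n := by
    have : 0 ≤ C / (κ / 2) := by positivity
    linarith
  have hCn : C ≤ n * (κ / 2) := by
    rw [← div_le_iff₀ (by positivity)]; linarith
  filter_upwards [eventually_ge_atTop (2 * R * n / (1 - r)), eventually_ge_atTop (R / r ^ 2),
    eventually_ge_atTop 0] with v hv1 hv2 hv0
  rw [div_le_iff₀ (by linarith)] at hv1
  rw [div_le_iff₀ (by positivity)] at hv2
  show p v * (1 - κ) ≤ _ + κ * p _
  have step : ∀ j ∈ Finset.range n, p v * (1 - κ) ≤ HH μ (r ^ 2 * v)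
      + HH μ R * p (r * (1 - r) * v)
      + C * (p (r * v + 2 * R * (j : ℕ) - R) - p (r * v + 2 * R * ((j + 1 : ℕ) : ℝ) - R)) := by
    intro j hj
    have hjn : (j : ℝ) ≤ n := by exact_mod_cast (Finset.mem_range.1 hj).le
    have hj0 : (0:ℝ) ≤ j := Nat.cast_nonneg j
    set u := r * v + 2 * R * (j : ℕ) with hu
    have hRj : 0 ≤ R * j := by positivity
    have hu0 : r * v ≤ u := by rw [hu]; linarith
    have huv : u ≤ v := by
      have : R * j ≤ R * n := by gcongr
      rw [hu]; linarith
    have hrv : 0 ≤ r * v := by positivity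
    have h := core_upper hint hmean hfix u (by linarith) (1 - r) R hR0
    have a1 : HH μ ((1 - (1 - r)) * u) ≤ HH μ (r ^ 2 * v) := HH_anti hint (by nlinarith)
    have a2 : HH μ R * p ((1 - r) * u) ≤ HH μ R * p (r * (1 - r) * v) :=
      mul_le_mul_of_nonneg_left (hpa (by nlinarith)) (HH_nonneg _)
    have e2 : r * v + 2 * R * ((j + 1 : ℕ) : ℝ) - R = u + R := by rw [hu]; push_cast; ring
    rw [e2]
    change p u ≤ HH μ ((1 - (1 - r)) * u) + HH μ R * p ((1 - r) * u)
      + C * (p (u - R) - p (u + R)) + GG μ R * p u at h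
    have a3 : p v * (1 - κ) ≤ p v * (1 - GG μ R) :=
      mul_le_mul_of_nonneg_left (by linarith) (hp0 v)
    have a4 : p v * (1 - GG μ R) ≤ p u * (1 - GG μ R) :=
      mul_le_mul_of_nonneg_right (hpa huv) (by linarith)
    linarith
  have hs := Finset.sum_le_sum step
  rw [Finset.sum_add_distrib, ← Finset.mul_sum _ _ C,
    Finset.sum_range_sub' (fun j : ℕ => p (r * v + 2 * R * (j:ℝ) - R))] at hs
  simp only [Finset.sum_const, Finset.card_range, nsmul_eq_mul] at hs
  have b1 : p (r * v + 2 * R * ((0:ℕ):ℝ) - R) ≤ p (r * (1 - r) * v) := hpa (by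
    simp only [Nat.cast_zero]; nlinarith)
  have b2 := hp0 (r * v + 2 * R * (n:ℝ) - R)
  have b3 : C * (p (r * v + 2 * R * ((0:ℕ):ℝ) - R) - p (r * v + 2 * R * (n:ℝ) - R)) ≤
      n * (κ / 2) * p (r * (1 - r) * v) := by
    have := hp0 (r * (1 - r) * v)
    calc _ ≤ C * p (r * (1 - r) * v) := by gcongr; linarith
      _ ≤ _ := by gcongr
  have b4 : HH μ R * p (r * (1 - r) * v) ≤ κ / 2 * p (r * (1 - r) * v) :=
    mul_le_mul_of_nonneg_right hR1 (hp0 _)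
  have b5 := mul_le_mul_of_nonneg_left b4 hnpos.le
  refine le_of_mul_le_mul_left ?_ hnpos
  have b6 := hs.trans (add_le_add le_rfl b3)
  clear hs b3 step
  linarith

end core


section prob
variable {Ω : Type*} [MeasurableSpace Ω] {P : Measure Ω} [IsProbabilityMeasure P]

lemma meas_sup_comap (η : ℕ → Ω → ℝ) (S : Set ℕ) (i : ℕ) (hi : i ∈ S) :
    Measurable[⨆ i ∈ S, MeasurableSpace.comap (η i) inferInstance] (η i) := by
  have : MeasurableSpace.comap (η i) inferInstance ≤
      ⨆ i ∈ S, MeasurableSpace.comap (η i) (inferInstance : MeasurableSpace ℝ) :=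
    le_iSup₂_of_le i hi le_rfl
  exact (comap_measurable (η i)).mono this le_rfl

lemma ottaviani_aux (η : ℕ → Ω → ℝ) (hm : ∀ i, Measurable (η i)) (hi : iIndepFun η P)
    (e : ℕ → ℕ) (he : ∀ k, k ≤ e k) (δ K u : ℝ) (hδ : δ ≤ 1)
    (hB : ∀ k, P.real {ω | ∑ i ∈ Finset.range (e k), η i ω - ∑ i ∈ Finset.range k, η i ω < -K} ≤ δ) :
    (1 - δ) * P.real {ω | ∃ k, u + K < ∑ i ∈ Finset.range k, η i ω} ≤
      P.real {ω | ∃ k, u < ∑ i ∈ Finset.range (e k), η i ω} := by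
  set S : ℕ → Ω → ℝ := fun k ω => ∑ i ∈ Finset.range k, η i ω with hS
  have hSm : ∀ k, Measurable (S k) := fun k => Finset.measurable_sum _ fun i _ => hm i
  let E : ℕ → Set Ω := fun k => {ω | u + K < S k ω} ∩ ⋂ j ∈ Finset.range k, {ω | S j ω ≤ u + K}
  let B : ℕ → Set Ω := fun k => {ω | S (e k) ω - S k ω < -K}
  have hEm : ∀ k, MeasurableSet (E k) := fun k =>
    (measurableSet_lt measurable_const (hSm k)).inter
      (Finset.measurableSet_biInter _ fun j _ => measurableSet_le (hSm j) measurable_const)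
  have hBm : ∀ k, MeasurableSet (B k) := fun k =>
    measurableSet_lt ((hSm _).sub (hSm _)) measurable_const
  have hEd : Pairwise (Function.onFun Disjoint E) := by
    intro a b hab
    rw [Function.onFun, Set.disjoint_left]
    intro ω h1 h2
    simp only [E, mem_inter_iff, mem_ofPred_eq, mem_iInter, Finset.mem_range] at h1 h2
    rcases lt_or_gt_of_ne hab with h | h
    · linarith [h2.2 a h, h1.1]
    · linarith [h1.2 b h, h2.1]
  have hEU : {ω | ∃ k, u + K < S k ω} = ⋃ k, E k := by
    classical
    ext ω
    simp only [mem_ofPred_eq, mem_iUnion, E, mem_inter_iff, mem_iInter, Finset.mem_range]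
    constructor
    · intro h
      refine ⟨Nat.find h, Nat.find_spec h, fun j hj => ?_⟩
      exact not_lt.1 (Nat.find_min h hj)
    · rintro ⟨k, h, -⟩
      exact ⟨k, h⟩
  have hind : ∀ k, P (E k ∩ (B k)ᶜ) = P (E k) * P (B k)ᶜ := by
    intro k
    have hI := indep_iSup_of_disjoint (m := fun i => MeasurableSpace.comap (η i) inferInstance)
      (fun i => (hm i).comap_le) hi (S := Iio k) (T := Ici k)
      (Set.disjoint_left.2 fun x hx hx' => by simp at hx hx'; omega)
    rw [Indep_iff] at hI
    have hsum : ∀ (T : Set ℕ) (s : Finset ℕ), (∀ i ∈ s, i ∈ T) →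
        Measurable[⨆ i ∈ T, MeasurableSpace.comap (η i) inferInstance]
          (fun ω => ∑ i ∈ s, η i ω) := by
      intro T s h
      exact Finset.measurable_sum _ fun i hi => meas_sup_comap η T i (h i hi)
    refine hI _ _ ?_ ?_
    · refine MeasurableSet.inter ?_ (Finset.measurableSet_biInter _ fun j hj => ?_)
      · exact (hsum (Iio k) (Finset.range k) (by simp)) measurableSet_Ioi
      · exact (hsum (Iio k) (Finset.range j) (by
          intro i hi; simp at hi hj ⊢; omega)) measurableSet_Iic
    · refine MeasurableSet.compl ?_
      have : B k = (fun ω => ∑ i ∈ Finset.Ico k (e k), η i ω) ⁻¹' (Iio (-K)) := by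
        ext ω
        simp only [B, mem_ofPred_eq, mem_preimage, mem_Iio, hS]
        rw [Finset.sum_Ico_eq_sub _ (he k)]
      rw [this]
      exact (hsum (Ici k) _ (by intro i hi; simp at hi ⊢; omega)) measurableSet_Iio
  have hBc : ∀ k, ENNReal.ofReal (1 - δ) ≤ P (B k)ᶜ := by
    intro k
    rw [← ofReal_measureReal (μ := P) (s := (B k)ᶜ), probReal_compl_eq_one_sub (hBm k)]
    exact ENNReal.ofReal_le_ofReal (by linarith [hB k])
  have main : ENNReal.ofReal (1 - δ) * P {ω | ∃ k, u + K < S k ω} ≤ P {ω | ∃ k, u < S (e k) ω} := by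
    rw [hEU, measure_iUnion hEd hEm, ← ENNReal.tsum_mul_left]
    calc ∑' k, ENNReal.ofReal (1 - δ) * P (E k) ≤ ∑' k, P (E k ∩ (B k)ᶜ) := by
          refine ENNReal.tsum_le_tsum fun k => ?_
          rw [hind, mul_comm]
          gcongr
          exact hBc k
      _ = P (⋃ k, E k ∩ (B k)ᶜ) := by
          rw [measure_iUnion _ fun k => (hEm k).inter (hBm k).compl]
          intro a b hab
          exact (hEd hab).mono inter_subset_left inter_subset_left
      _ ≤ _ := by
          refine measure_mono fun ω hω => ?_
          obtain ⟨k, ⟨h1, -⟩, h2⟩ := mem_iUnion.1 hω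
          simp only [B, mem_compl_iff, mem_ofPred_eq, not_lt] at h1 h2
          exact ⟨k, by linarith⟩
  have := ENNReal.toReal_mono (measure_ne_top P _) main
  rwa [ENNReal.toReal_mul, ENNReal.toReal_ofReal (by linarith)] at this

lemma lindley_aux (η : ℕ → Ω → ℝ) (hm : ∀ i, Measurable (η i)) (hi : iIndepFun η P)
    (μ : Measure ℝ) (hμ : ∀ i, P.map (η i) = μ)
    (hbd : ∀ᵐ ω ∂P, BddAbove (range fun k => ∑ i ∈ Finset.range k, η i ω)) :
    let ν := P.map (fun ω => ⨆ k, ∑ i ∈ Finset.range k, η i ω)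
    ν = (ν.prod μ).map (fun z => max 0 (z.1 + z.2)) := by
  intro ν
  let Φ : (ℕ → ℝ) → ℝ := fun x => ⨆ k, ∑ i ∈ Finset.range k, x i
  have hΦ : Measurable Φ := Measurable.iSup fun k =>
    Finset.measurable_sum _ fun i _ => measurable_pi_apply i
  let tl : Ω → (ℕ → ℝ) := fun ω i => η (i + 1) ω
  have htl : Measurable tl := measurable_pi_lambda _ fun i => hm (i + 1)
  have hsq : Measurable (fun ω i => η i ω) := measurable_pi_lambda _ hm
  have l1 : P.map (fun ω i => η i ω) = Measure.infinitePi fun _ => μ := by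
    rw [(iIndepFun_iff_map_fun_eq_infinitePi_map hm).1 hi]
    simp_rw [hμ]
  have l2 : P.map tl = Measure.infinitePi fun _ => μ := by
    rw [(iIndepFun_iff_map_fun_eq_infinitePi_map (fun i => hm (i + 1))).1
      (hi.precomp (g := fun i => i + 1) (add_left_injective 1))]
    simp_rw [hμ]
  have hν : ν = P.map (fun ω => Φ (tl ω)) := by
    have a1 : ν = (P.map (fun ω i => η i ω)).map Φ := by
      rw [Measure.map_map hΦ hsq]; rfl
    rw [a1, l1, ← l2, Measure.map_map hΦ htl]; rfl
  have hΦtl : Measurable (fun ω => Φ (tl ω)) := hΦ.comp htl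
  have hind : IndepFun tl (η 0) P := by
    rw [IndepFun_iff_Indep]
    have hI := indep_iSup_of_disjoint (m := fun i => MeasurableSpace.comap (η i) inferInstance)
      (fun i => (hm i).comap_le) hi (S := Ici 1) (T := {0})
      (Set.disjoint_left.2 fun x hx hx' => by simp at hx hx'; omega)
    refine indep_of_indep_of_le_left (indep_of_indep_of_le_right hI ?_) ?_
    · exact le_iSup₂_of_le 0 rfl le_rfl
    · have hmt : Measurable[⨆ i ∈ Ici 1, MeasurableSpace.comap (η i) inferInstance] tl :=
        @measurable_pi_lambda _ _ _ (⨆ i ∈ Ici 1, MeasurableSpace.comap (η i) inferInstance) _ _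
          fun i => meas_sup_comap η (Ici 1) (i + 1) (by simp)
      exact hmt.comap_le
  have hind2 : IndepFun (fun ω => Φ (tl ω)) (η 0) P := hind.comp hΦ measurable_id
  have hpr : P.map (fun ω => (Φ (tl ω), η 0 ω)) = ν.prod μ := by
    rw [(indepFun_iff_map_prod_eq_prod_map_map hΦtl.aemeasurable (hm 0).aemeasurable).1 hind2,
      ← hν, hμ]
  rw [← hpr, Measure.map_map (by fun_prop) (hΦtl.prodMk (hm 0))]
  refine Measure.map_congr ?_
  filter_upwards [hbd] with ω hω
  simp only [Function.comp, Φ, tl]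
  have hS : ∀ k, ∑ i ∈ Finset.range (k + 1), η i ω = ∑ i ∈ Finset.range k, η (i + 1) ω + η 0 ω :=
    fun k => Finset.sum_range_succ' (fun i => η i ω) k
  have hbd2 : BddAbove (range fun k => ∑ i ∈ Finset.range k, η (i + 1) ω) := by
    obtain ⟨b, hb⟩ := hω
    refine ⟨b - η 0 ω, ?_⟩
    rintro _ ⟨k, rfl⟩
    have := hb ⟨k + 1, rfl⟩
    simp only [hS] at this ⊢
    linarith
  apply le_antisymm
  · refine ciSup_le fun k => ?_
    cases k with
    | zero => simp
    | succ k =>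
      rw [hS]
      refine le_max_of_le_right ?_
      have := le_ciSup hbd2 k
      linarith
  · refine max_le ?_ ?_
    · exact le_trans (by simp) (le_ciSup hω 0)
    · rw [← le_sub_iff_add_le]
      refine ciSup_le fun k => ?_
      have := le_ciSup hω (k + 1)
      simp only [hS] at this
      linarith

lemma bdd_aux (η : ℕ → Ω → ℝ) (hm : ∀ i, Measurable (η i)) (hi : iIndepFun η P)
    (hid : ∀ i, P.map (η i) = P.map (η 0)) (hint : Integrable (η 0) P) (hmean : ∫ ω, η 0 ω ∂P = -1) :
    ∀ᵐ ω ∂P, BddAbove (range fun k => ∑ i ∈ Finset.range k, η i ω) := by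
  have h := strong_law_ae_real η hint (fun i j hij => hi.indepFun hij)
    (fun i => ⟨(hm i).aemeasurable, (hm 0).aemeasurable, hid i⟩)
  filter_upwards [h] with ω hω
  rw [hmean] at hω
  have h1 : ∀ᶠ n : ℕ in atTop, ∑ i ∈ Finset.range n, η i ω ≤ 0 := by
    filter_upwards [hω.eventually (gt_mem_nhds (show (-1:ℝ) < 0 by norm_num)), eventually_gt_atTop 0]
      with n hn hn0
    have : (0:ℝ) < n := by exact_mod_cast hn0
    rw [div_lt_iff₀ this] at hn
    linarith
  exact (Filter.isBoundedUnder_of_eventually_le h1).bddAbove_range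

end prob

structure LevyH {Ω : Type*} [MeasurableSpace Ω] (P : Measure Ω) (X : ℝ → Ω → ℝ) : Prop where
  meas : ∀ t : ℝ, Measurable (X t)
  zero : ∀ᵐ ω ∂P, X 0 ω = 0
  path : ∀ᵐ ω ∂P, ∀ t : ℝ, 0 ≤ t →
      ContinuousWithinAt (fun s => X s ω) (Set.Ici t) t ∧
      (0 < t → ∃ l : ℝ, Tendsto (fun s => X s ω) (nhdsWithin t (Set.Iio t)) (nhds l))
  stat : ∀ s t : ℝ, 0 ≤ s → s ≤ t →
      Measure.map (fun ω => X t ω - X s ω) P = Measure.map (X (t - s)) P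
  incr : ∀ (n : ℕ) (t : Fin (n + 1) → ℝ), (∀ i, 0 ≤ t i) → StrictMono t →
      iIndepFun
        (fun i : Fin n => fun ω => X (t i.succ) ω - X (t i.castSucc) ω) P
  int : Integrable (X 1) P
  mean : ∫ ω, X 1 ω ∂P = 0

section levy
variable {Ω : Type*} [MeasurableSpace Ω] {P : Measure Ω} [IsProbabilityMeasure P]
  {X : ℝ → Ω → ℝ}

lemma LevyH.msub (h : LevyH P X) (s t : ℝ) : Measurable (fun ω => X t ω - X s ω) :=
  (h.meas t).sub (h.meas s)

lemma LevyH.neg (h : LevyH P X) : LevyH P (fun t ω => - X t ω) where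
  meas t := (h.meas t).neg
  zero := by filter_upwards [h.zero] with ω hω; simp [hω]
  path := by
    filter_upwards [h.path] with ω hω t ht
    refine ⟨(hω t ht).1.neg, fun h0 => ?_⟩
    obtain ⟨l, hl⟩ := (hω t ht).2 h0
    exact ⟨-l, hl.neg⟩
  stat s t hs hst := by
    have a := congrArg (fun m => Measure.map (fun x : ℝ => -x) m) (h.stat s t hs hst)
    rw [Measure.map_map (by fun_prop) (h.msub s t),
      Measure.map_map (by fun_prop) (h.meas _)] at a
    rw [show (fun ω => -X t ω - -X s ω) = (fun x : ℝ => -x) ∘ (fun ω => X t ω - X s ω) from by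
      ext ω; simp; ring]
    exact a
  incr n t h0 hm := by
    have a := (h.incr n t h0 hm).comp (fun _ x => -x) (fun _ => measurable_neg)
    convert a using 2 with i
    ext ω; simp; ring
  int := h.int.neg
  mean := by rw [integral_neg, h.mean, neg_zero]

/-- increments of the drifted process on a grid -/
def incs (X : ℝ → Ω → ℝ) (h : ℝ) (i : ℕ) (ω : Ω) : ℝ :=
  X (((i + 1 : ℕ) : ℝ) * h) ω - X ((i : ℝ) * h) ω - h

lemma incs_meas (hX : LevyH P X) (h : ℝ) (i : ℕ) : Measurable (incs X h i) :=
  ((hX.meas _).sub (hX.meas _)).sub_const h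

lemma incs_indep (hX : LevyH P X) (h : ℝ) (hh : 0 < h) : iIndepFun (incs X h) P := by
  have h1 : iIndepFun (fun (i : ℕ) ω => X (((i + 1 : ℕ) : ℝ) * h) ω - X ((i : ℝ) * h) ω) P := by
    rw [iIndepFun_iff_finset]
    intro s
    obtain ⟨n, hn⟩ := s.exists_nat_subset_range
    have a := hX.incr n (fun j => ((j : ℕ) : ℝ) * h) (fun j => by positivity) (by
      intro a b hab
      have : ((a : ℕ) : ℝ) < (b : ℕ) := by exact_mod_cast hab
      simp only
      gcongr)
    have g := a.precomp (g := fun i : s => (⟨i.1, Finset.mem_range.1 (hn i.2)⟩ : Fin n)) (by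
      intro x y hxy
      simp at hxy
      exact hxy)
    exact g
  exact h1.comp (fun _ x => x - h) (fun _ => measurable_id.sub_const h)

lemma incs_law (hX : LevyH P X) (h : ℝ) (hh : 0 < h) (i : ℕ) :
    P.map (incs X h i) = P.map (fun ω => X h ω - h) := by
  have a := congrArg (fun m => Measure.map (fun x : ℝ => x - h) m)
    (hX.stat ((i : ℝ) * h) (((i + 1 : ℕ) : ℝ) * h) (by positivity) (by
      push_cast; nlinarith))
  rw [Measure.map_map (by fun_prop) (hX.msub _ _),
      Measure.map_map (by fun_prop) (hX.meas _)] at a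
  rw [show ((i + 1 : ℕ) : ℝ) * h - (i : ℝ) * h = h from by push_cast; ring] at a
  exact a

lemma incs_sum (X : ℝ → Ω → ℝ) (h : ℝ) (k : ℕ) (ω : Ω) :
    ∑ i ∈ Finset.range k, incs X h i ω = X ((k : ℝ) * h) ω - X 0 ω - k * h := by
  unfold incs
  rw [Finset.sum_sub_distrib, Finset.sum_range_sub (fun i : ℕ => X ((i : ℝ) * h) ω)]
  simp


lemma rc_aux (f : ℝ → ℝ) (t a : ℝ) (ht : 0 ≤ t) (hf : ContinuousWithinAt f (Ici t) t)
    (h : a < f t) : ∃ n k : ℕ, a < f ((k : ℝ) * (1 / 2 ^ n)) := by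
  have h1 : Tendsto (fun n : ℕ => ((⌈t * 2 ^ n⌉₊ : ℕ) : ℝ) * (1 / 2 ^ n)) atTop
      (nhdsWithin t (Ici t)) := by
    rw [tendsto_nhdsWithin_iff]
    constructor
    · have hu : Tendsto (fun n : ℕ => t + (1 / 2 : ℝ) ^ n) atTop (nhds (t + 0)) :=
        tendsto_const_nhds.add (tendsto_pow_atTop_nhds_zero_of_lt_one (by norm_num) (by norm_num))
      rw [add_zero] at hu
      refine tendsto_of_tendsto_of_tendsto_of_le_of_le tendsto_const_nhds hu ?_ ?_
      · intro n
        have := Nat.le_ceil (t * 2 ^ n)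
        simp only
        rw [mul_one_div, le_div_iff₀ (by positivity)]
        exact this
      · intro n
        have := (Nat.ceil_lt_add_one (show 0 ≤ t * 2 ^ n by positivity)).le
        simp only
        rw [mul_one_div, div_le_iff₀ (by positivity), add_mul, one_div, inv_pow,
          inv_mul_cancel₀ (by positivity)]
        exact this
    · filter_upwards with n
      have := Nat.le_ceil (t * 2 ^ n)
      rw [mem_Ici, mul_one_div, le_div_iff₀ (by positivity)]
      exact this
  obtain ⟨n, hn⟩ := ((hf.tendsto.comp h1).eventually (lt_mem_nhds h)).exists
  exact ⟨n, _, hn⟩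

lemma cadlag_bdd (f : ℝ → ℝ) (hf : ∀ t : ℝ, 0 ≤ t → ContinuousWithinAt f (Set.Ici t) t ∧
      (0 < t → ∃ l : ℝ, Tendsto f (nhdsWithin t (Set.Iio t)) (nhds l))) :
    ∃ B : ℝ, ∀ s ∈ Icc (0:ℝ) 1, 0 ≤ s → -B ≤ f s := by
  refine isCompact_Icc.induction_on (p := fun S => ∃ B : ℝ, ∀ s ∈ S, 0 ≤ s → -B ≤ f s) ?_ ?_ ?_ ?_
  · exact ⟨0, by simp⟩
  · rintro S T hST ⟨B, hB⟩
    exact ⟨B, fun s hs => hB s (hST hs)⟩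
  · rintro S T ⟨B, hB⟩ ⟨B', hB'⟩
    refine ⟨max B B', ?_⟩
    rintro s (hs | hs) h0
    · linarith [hB s hs h0, le_max_left B B']
    · linarith [hB' s hs h0, le_max_right B B']
  · intro t ht
    obtain ⟨h1, h2⟩ := hf t ht.1
    have e1 : ∀ᶠ s in nhdsWithin t (Ici t), f t - 1 < f s :=
      h1.tendsto.eventually (lt_mem_nhds (by linarith))
    have e2 : ∃ b, ∀ᶠ s in nhdsWithin t (Iio t), 0 ≤ s → b < f s := by
      rcases ht.1.lt_or_eq with h | h
      · obtain ⟨l, hl⟩ := h2 h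
        refine ⟨l - 1, ?_⟩
        filter_upwards [hl.eventually (lt_mem_nhds (show l - 1 < l by linarith))] with s hs _
        exact hs
      · refine ⟨0, ?_⟩
        filter_upwards [self_mem_nhdsWithin] with s hs h0
        rw [mem_Iio] at hs
        linarith
    obtain ⟨b, hb⟩ := e2
    have e3 : ∀ᶠ s in nhds t, 0 ≤ s → min b (f t - 1) ≤ f s := by
      rw [← nhdsLT_sup_nhdsGE, eventually_sup]
      constructor
      · filter_upwards [hb] with s hs h0
        exact (min_le_left _ _).trans (hs h0).le
      · filter_upwards [e1] with s hs h0
        exact (min_le_right _ _).trans hs.le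
    refine ⟨{s | 0 ≤ s → min b (f t - 1) ≤ f s}, mem_nhdsWithin_of_mem_nhds e3,
      -min b (f t - 1), ?_⟩
    intro s hs h0
    rw [neg_neg]
    exact hs h0

lemma tight_aux (hX : LevyH P X) (δ : ℝ) (hδ : 0 < δ) : ∃ K : ℝ, 0 ≤ K ∧ ∀ n k : ℕ, k ≤ 2 ^ n →
    P.real {ω | X ((k : ℝ) * (1 / 2 ^ n)) ω - (k : ℝ) * (1 / 2 ^ n) < -K} ≤ δ := by
  let C : ℕ → Set Ω := fun K => ⋃ n : ℕ, ⋃ k : ℕ, ⋃ _ : k ≤ 2 ^ n,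
    {ω | X ((k : ℝ) * (1 / 2 ^ n)) ω - (k : ℝ) * (1 / 2 ^ n) < -(K : ℝ)}
  have hCm : ∀ K, MeasurableSet (C K) := fun K =>
    MeasurableSet.iUnion fun n => MeasurableSet.iUnion fun k => MeasurableSet.iUnion fun _ =>
      measurableSet_lt ((hX.meas _).sub_const _) measurable_const
  have hanti : Antitone C := by
    intro K L hKL ω hω
    simp only [C, mem_iUnion, mem_ofPred_eq] at hω ⊢
    obtain ⟨n, k, hk, h⟩ := hω
    have : (K : ℝ) ≤ L := by exact_mod_cast hKL
    exact ⟨n, k, hk, by linarith⟩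
  have hz : P (⋂ K, C K) = 0 := by
    rw [measure_eq_zero_iff_ae_notMem]
    filter_upwards [hX.path] with ω hω hmem
    obtain ⟨B, hB⟩ := cadlag_bdd _ hω
    obtain ⟨K, hK⟩ := exists_nat_ge (B + 1)
    have := mem_iInter.1 hmem K
    simp only [C, mem_iUnion, mem_ofPred_eq] at this
    obtain ⟨n, k, hk, h⟩ := this
    have hs0 : 0 ≤ (k : ℝ) * (1 / 2 ^ n) := by positivity
    have hs1 : (k : ℝ) * (1 / 2 ^ n) ≤ 1 := by
      rw [mul_one_div, div_le_one (by positivity)]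
      exact_mod_cast hk
    have := hB _ ⟨hs0, hs1⟩ hs0
    linarith
  have ht := tendsto_measure_iInter_atTop (μ := P) (fun K => (hCm K).nullMeasurableSet) hanti
    ⟨0, measure_ne_top _ _⟩
  rw [hz] at ht
  obtain ⟨K, hK⟩ := (ht.eventually (gt_mem_nhds (ENNReal.ofReal_pos.2 hδ))).exists
  refine ⟨K, Nat.cast_nonneg K, fun n k hk => ?_⟩
  rw [measureReal_def]
  refine ENNReal.toReal_le_of_le_ofReal hδ.le (le_trans (measure_mono ?_) hK.le)
  intro ω hω
  simp only [C, mem_iUnion]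
  exact ⟨n, k, hk, hω⟩

lemma otta_levy (hX : LevyH P X) (δ : ℝ) (hδ : 0 < δ) (hδ1 : δ < 1) : ∃ K : ℝ, 0 ≤ K ∧ ∀ u : ℝ,
    (1 - δ) * P.real {ω | ∃ t, 0 ≤ t ∧ u + K < X t ω - t} ≤
      P.real {ω | ∃ n : ℕ, u < X n ω - n} := by
  obtain ⟨K, hK0, hK⟩ := tight_aux hX δ hδ
  refine ⟨K, hK0, fun u => ?_⟩
  let A : ℕ → Set Ω := fun n => {ω | ∃ k : ℕ, u + K < X ((k:ℝ) * (1 / 2 ^ n)) ω - (k:ℝ) * (1 / 2 ^ n)}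
  have hmono : Monotone A := by
    refine monotone_nat_of_le_succ fun n ω hω => ?_
    obtain ⟨k, hk⟩ := hω
    refine ⟨2 * k, ?_⟩
    have : ((2 * k : ℕ) : ℝ) * (1 / 2 ^ (n + 1)) = (k:ℝ) * (1 / 2 ^ n) := by
      push_cast; rw [pow_succ]; field_simp
    rw [this]; exact hk
  have hb : ∀ n, (1 - δ) * P.real (A n) ≤ P.real {ω | ∃ n : ℕ, u < X n ω - n} := by
    intro n
    set h : ℝ := 1 / 2 ^ n with hh
    have hpos : 0 < h := by positivity
    have h2 : (2:ℝ) ^ n * h = 1 := by rw [hh]; field_simp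
    let e : ℕ → ℕ := fun k => ((k + 2 ^ n - 1) / 2 ^ n) * 2 ^ n
    have hp : 0 < 2 ^ n := by positivity
    have he1 : ∀ k, k ≤ e k ∧ e k ≤ k + 2 ^ n := by
      intro k
      have a := Nat.div_add_mod (k + 2 ^ n - 1) (2 ^ n)
      have b := Nat.mod_lt (k + 2 ^ n - 1) hp
      simp only [e]
      rw [mul_comm]
      omega
    have := ottaviani_aux (P := P) (incs X h) (incs_meas hX h) (incs_indep hX h hpos) e
      (fun k => (he1 k).1) δ K u hδ1.le (by
        intro k
        simp only [incs_sum]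
        obtain ⟨m, hm⟩ := Nat.exists_eq_add_of_le (he1 k).1
        have hm2 : m ≤ 2 ^ n := by have := (he1 k).2; omega
        have hc : ((e k : ℕ) : ℝ) = k + m := by rw [hm]; push_cast; rfl
        have hst := hX.stat ((k:ℝ) * h) ((e k : ℝ) * h) (by positivity) (by
          rw [hc]; gcongr; linarith [Nat.cast_nonneg (α := ℝ) m])
        rw [show (e k : ℝ) * h - k * h = m * h from by rw [hc]; ring] at hst
        have hst2 := congrArg (fun μ => μ.real (Iio (-K + m * h))) hst
        rw [map_measureReal_apply (hX.msub _ _) measurableSet_Iio,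
          map_measureReal_apply (hX.meas _) measurableSet_Iio] at hst2
        refine le_trans (le_of_eq ?_) (hK n m hm2)
        convert hst2 using 2
        · ext ω
          simp only [mem_ofPred_eq, mem_preimage, mem_Iio, hc]
          constructor <;> intro h <;> linarith
        · ext ω
          simp only [mem_ofPred_eq, mem_preimage, mem_Iio]
          constructor <;> intro h <;> linarith)
    have c1 : P.real (A n) = P.real {ω | ∃ k, u + K < ∑ i ∈ Finset.range k, incs X h i ω} := by
      refine measureReal_congr ?_
      filter_upwards [hX.zero] with ω hω
      refine propext ?_
      show (∃ k : ℕ, _) ↔ (∃ k : ℕ, _)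
      simp only [incs_sum, hω, sub_zero]
      rfl
    rw [c1]
    refine this.trans ?_
    have c2 : P.real {ω | ∃ k, u < ∑ i ∈ Finset.range (e k), incs X h i ω} ≤
      P.real {ω | X 0 ω = 0 → ∃ n : ℕ, u < X n ω - n} := by
      refine measureReal_mono ?_
      rintro ω ⟨k, hk⟩ h0
      rw [incs_sum, h0, sub_zero] at hk
      refine ⟨(k + 2 ^ n - 1) / 2 ^ n, ?_⟩
      have : ((e k : ℕ) : ℝ) * h = (((k + 2 ^ n - 1) / 2 ^ n : ℕ) : ℝ) := by
        simp only [e]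
        rw [Nat.cast_mul, mul_assoc]
        push_cast
        rw [h2, mul_one]
      rw [this] at hk
      exact hk
    refine c2.trans (le_of_eq (measureReal_congr ?_))
    filter_upwards [hX.zero] with ω hω
    refine propext ?_
    show (_ → _) ↔ _
    exact ⟨fun h => h hω, fun h _ => h⟩
  have hU : P.real {ω | ∃ t, 0 ≤ t ∧ u + K < X t ω - t} ≤ P.real (⋃ n, A n) := by
    rw [measureReal_def, measureReal_def]
    refine ENNReal.toReal_mono (measure_ne_top _ _) (measure_mono_ae ?_)
    filter_upwards [hX.path] with ω hω
    rintro ⟨t, ht, h⟩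
    obtain ⟨n, k, hk⟩ := rc_aux (fun s => X s ω - s) t (u + K) ht
      ((hω t ht).1.sub continuousWithinAt_id) h
    exact mem_iUnion.2 ⟨n, k, hk⟩
  have hlim : Tendsto (fun n => (1 - δ) * P.real (A n)) atTop (nhds ((1 - δ) * P.real (⋃ n, A n))) := by
    refine Tendsto.const_mul _ ?_
    exact (ENNReal.tendsto_toReal (measure_ne_top _ _)).comp (tendsto_measure_iUnion_atTop hmono)
  have := le_of_tendsto' hlim hb
  refine le_trans ?_ this
  gcongr

/-- law of the discrete supremum -/
noncomputable def nuX (P : Measure Ω) (X : ℝ → Ω → ℝ) : Measure ℝ :=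
  P.map (fun ω => ⨆ k, ∑ i ∈ Finset.range k, incs X 1 i ω)

lemma sup_meas (hX : LevyH P X) : Measurable (fun ω => ⨆ k, ∑ i ∈ Finset.range k, incs X 1 i ω) :=
  Measurable.iSup fun k => Finset.measurable_sum _ fun i _ => incs_meas hX 1 i

lemma incs_bdd (hX : LevyH P X) :
    ∀ᵐ ω ∂P, BddAbove (range fun k => ∑ i ∈ Finset.range k, incs X 1 i ω) := by
  have hid : IdentDistrib (incs X 1 0) (fun ω => X 1 ω - 1) P P :=
    ⟨(incs_meas hX 1 0).aemeasurable, ((hX.meas 1).sub_const 1).aemeasurable,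
      incs_law hX 1 one_pos 0⟩
  refine bdd_aux (incs X 1) (incs_meas hX 1) (incs_indep hX 1 one_pos) (fun i => by
    rw [incs_law hX 1 one_pos, incs_law hX 1 one_pos]) ?_ ?_
  · exact hid.symm.integrable_snd (hX.int.sub (integrable_const 1))
  · rw [hid.integral_eq, integral_sub hX.int (integrable_const 1), hX.mean]; simp

lemma nuX_prob (hX : LevyH P X) : IsProbabilityMeasure (nuX P X) :=
  Measure.isProbabilityMeasure_map (sup_meas hX).aemeasurable

lemma nuX_Ioi (hX : LevyH P X) (u : ℝ) :
    (nuX P X).real (Ioi u) = P.real {ω | ∃ n : ℕ, u < X n ω - n} := by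
  unfold nuX
  rw [map_measureReal_apply (sup_meas hX) measurableSet_Ioi]
  refine measureReal_congr ?_
  filter_upwards [incs_bdd hX, hX.zero] with ω hω h0
  refine propext ?_
  show u < _ ↔ ∃ n : ℕ, _
  rw [lt_ciSup_iff hω]
  simp only [incs_sum, h0, mul_one, sub_zero]

lemma Ioi_tendsto (ν : Measure ℝ) [IsProbabilityMeasure ν] :
    Tendsto (fun u => ν.real (Ioi u)) atTop (nhds 0) := by
  have h : Tendsto (fun u => 1 - cdf ν u) atTop (nhds (1 - 1)) :=
    tendsto_const_nhds.sub (tendsto_cdf_atTop ν)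
  rw [sub_self] at h
  refine h.congr fun u => ?_
  rw [cdf_eq_real, ← probReal_compl_eq_one_sub measurableSet_Iic, compl_Iic]

lemma levy_bdd (hX : LevyH P X) : ∀ᵐ ω ∂P, ∃ B : ℝ, ∀ t, 0 ≤ t → X t ω - t ≤ B := by
  obtain ⟨K, hK0, hK⟩ := otta_levy hX (1/2) (by norm_num) (by norm_num)
  have := nuX_prob hX
  have ht := (Ioi_tendsto (nuX P X)).const_mul 2
  rw [mul_zero] at ht
  have hle : ∀ u : ℝ, P.real {ω | ¬ ∃ B : ℝ, ∀ t, 0 ≤ t → X t ω - t ≤ B} ≤ 2 * (nuX P X).real (Ioi u) := by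
    intro u
    rw [nuX_Ioi hX]
    have h1 := hK u
    have h2 : P.real {ω | ¬ ∃ B : ℝ, ∀ t, 0 ≤ t → X t ω - t ≤ B} ≤
        P.real {ω | ∃ t, 0 ≤ t ∧ u + K < X t ω - t} := by
      refine measureReal_mono ?_
      intro ω hω
      by_contra hc
      refine hω ⟨u + K, fun t ht => ?_⟩
      by_contra hc2
      exact hc ⟨t, ht, not_le.1 hc2⟩
    linarith
  have h0 := ge_of_tendsto' ht hle
  rw [ae_iff]
  have h3 : P.real {ω | ¬ ∃ B : ℝ, ∀ t, 0 ≤ t → X t ω - t ≤ B} = 0 := le_antisymm h0 measureReal_nonneg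
  exact (measureReal_eq_zero_iff).1 h3

end levy


lemma final_aux (N q p H : ℝ → ℝ) (γ : ℝ) (hH : Antitone H) (hpos : ∀ x, 0 < H x)
    (hR : ∀ c : ℝ, 0 < c → Tendsto (fun x => H (c * x) / H x) atTop (nhds (c ^ γ)))
    (hpq : ∀ u, p u ≤ q u) (hqa : Antitone q)
    (hqp : ∀ δ : ℝ, 0 < δ → δ < 1 → ∃ K : ℝ, 0 ≤ K ∧ ∀ u, (1 - δ) * q (u + K) ≤ p u)
    (hc : ∀ ε > 0, ∀ᶠ v in atTop, p v ≤ (1 + ε) * H v)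
    (hd : ∀ u, 0 ≤ u → H (u + 1) * (1 - p u) ≤ p u)
    (hp0 : Tendsto p atTop (nhds 0))
    (hNq : ∀ u, N u ≤ q u)
    (he : ∀ ε : ℝ, 0 < ε → ε < 1 → ∀ᶠ u in atTop, (1 - ε) * q ((1 + ε) * u) ≤ N u) :
    Tendsto (fun u => N u / H u) atTop (nhds 1) := by
  have hev : ∀ᶠ e : ℝ in nhdsWithin 0 (Ioi 0), 0 < e ∧ e < 1 / 2 := by
    have := Ioo_mem_nhdsGT (show (0:ℝ) < 1 / 2 by norm_num)
    filter_upwards [this] with e he using he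
  rw [tendsto_order]
  constructor
  · intro b hb
    have hl : Tendsto (fun e : ℝ => (1 - e) ^ 2 * ((1 + 2 * e) ^ γ - e)) (nhdsWithin 0 (Ioi 0))
        (nhds 1) := by
      have : ContinuousAt (fun e : ℝ => (1 - e) ^ 2 * ((1 + 2 * e) ^ γ - e)) 0 := by
        apply ContinuousAt.mul (by fun_prop)
        apply ContinuousAt.sub _ continuousAt_id
        exact ContinuousAt.rpow_const (by fun_prop) (Or.inl (by norm_num))
      have h := this.tendsto
      simp only [mul_zero, sub_zero, add_zero, Real.one_rpow, one_pow, mul_one] at h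
      exact h.mono_left nhdsWithin_le_nhds
    obtain ⟨e, he1, he0, he2⟩ := ((hl.eventually (lt_mem_nhds hb)).and hev).exists
    have h1 := (hR (1 + 2 * e) (by linarith)).eventually
      (lt_mem_nhds (show (1 + 2 * e) ^ γ - e < (1 + 2 * e) ^ γ by linarith))
    have hm : Tendsto (fun u : ℝ => (1 + e) * u) atTop atTop :=
      tendsto_id.const_mul_atTop (by linarith)
    have h2 := hm.eventually (hp0.eventually (gt_mem_nhds he0))
    filter_upwards [h1, h2, he e he0 (by linarith), eventually_ge_atTop (1 / e)] with u a1 a2 a3 a4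
    have hu : 0 < u := lt_of_lt_of_le (by positivity) a4
    have a5 := hd ((1 + e) * u) (by positivity)
    have a6 : H ((1 + 2 * e) * u) ≤ H ((1 + e) * u + 1) := by
      apply hH
      rw [div_le_iff₀ he0] at a4
      nlinarith
    have a7 : H ((1 + 2 * e) * u) * (1 - e) ≤ p ((1 + e) * u) := by
      refine le_trans ?_ a5
      exact mul_le_mul a6 (by linarith) (by linarith) (hpos _).le
    have a8 := hpq ((1 + e) * u)
    refine lt_of_lt_of_le he1 ?_
    rw [le_div_iff₀ (hpos u)]
    rw [lt_div_iff₀ (hpos u)] at a1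
    calc (1 - e) ^ 2 * ((1 + 2 * e) ^ γ - e) * H u
        = (1 - e) ^ 2 * (((1 + 2 * e) ^ γ - e) * H u) := by ring
      _ ≤ (1 - e) ^ 2 * H ((1 + 2 * e) * u) := by gcongr
      _ = (1 - e) * (H ((1 + 2 * e) * u) * (1 - e)) := by ring
      _ ≤ (1 - e) * q ((1 + e) * u) := by
        apply mul_le_mul_of_nonneg_left (a7.trans a8) (by linarith)
      _ ≤ N u := a3
  · intro b hb
    have hl : Tendsto (fun e : ℝ => (1 + e) / (1 - e) * ((1 - e) ^ γ + e)) (nhdsWithin 0 (Ioi 0))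
        (nhds 1) := by
      have : ContinuousAt (fun e : ℝ => (1 + e) / (1 - e) * ((1 - e) ^ γ + e)) 0 := by
        apply ContinuousAt.mul
        · exact ContinuousAt.div (by fun_prop) (by fun_prop) (by norm_num)
        apply ContinuousAt.add _ continuousAt_id
        exact ContinuousAt.rpow_const (by fun_prop) (Or.inl (by norm_num))
      have h := this.tendsto
      simp only [sub_zero, add_zero, Real.one_rpow, div_one, mul_one] at h
      exact h.mono_left nhdsWithin_le_nhds
    obtain ⟨e, he1, he0, he2⟩ := ((hl.eventually (gt_mem_nhds hb)).and hev).exists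
    have h1 := (hR (1 - e) (by linarith)).eventually
      (gt_mem_nhds (show (1 - e) ^ γ < (1 - e) ^ γ + e by linarith))
    have hm : Tendsto (fun u : ℝ => (1 - e) * u) atTop atTop :=
      tendsto_id.const_mul_atTop (by linarith)
    have h2 := hm.eventually (hc e he0)
    obtain ⟨K, hK0, hK⟩ := hqp e he0 (by linarith)
    filter_upwards [h1, h2, eventually_ge_atTop (K / e)] with u a1 a2 a4
    refine lt_of_le_of_lt ?_ he1
    rw [div_le_iff₀ (hpos u)]
    rw [div_lt_iff₀ (hpos u)] at a1
    have hp : 0 < 1 - e := by linarith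
    have a5 : q u ≤ q ((1 - e) * u + K) := by
      apply hqa
      rw [div_le_iff₀ he0] at a4
      nlinarith
    have a6 := hK ((1 - e) * u)
    have a7 : (1 - e) * q u ≤ (1 + e) * (((1 - e) ^ γ + e) * H u) :=
      calc (1 - e) * q u ≤ (1 - e) * q ((1 - e) * u + K) := by gcongr
        _ ≤ (1 + e) * H ((1 - e) * u) := a6.trans a2
        _ ≤ _ := by gcongr
    refine (hNq u).trans ?_
    rw [show (1 + e) / (1 - e) * ((1 - e) ^ γ + e) * H u
      = ((1 + e) * (((1 - e) ^ γ + e) * H u)) / (1 - e) from by ring, le_div_iff₀ hp]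
    linarith


section assembly
variable {Ω : Type*} [MeasurableSpace Ω] {P : Measure Ω} [IsProbabilityMeasure P]
  {X : ℝ → Ω → ℝ}

lemma layer_aux (hX : LevyH P X) (y : ℝ) :
    HH (P.map (fun ω => X 1 ω - 1)) (y - 1) = ∫ t in Ioi y, (P {ω | t < X 1 ω}).toReal := by
  unfold HH
  rw [integral_map ((hX.meas 1).sub_const 1).aemeasurable
    (by exact Measurable.aestronglyMeasurable (by fun_prop))]
  have hi : Integrable (fun ω => max (X 1 ω - 1 - (y - 1)) 0) P :=
    ((hX.int.sub (integrable_const 1)).sub (integrable_const (y - 1))).pos_part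
  rw [hi.integral_eq_integral_meas_lt (ae_of_all _ fun ω => le_max_right _ _)]
  have h := (measurePreserving_add_right (volume : Measure ℝ) y).setIntegral_preimage_emb
    (measurableEmbedding_addRight y) (fun t => (P {ω | t < X 1 ω}).toReal) (Ioi y)
  rw [← h]
  have hs : (fun x : ℝ => x + y) ⁻¹' Ioi y = Ioi 0 := by ext x; simp
  rw [hs]
  refine setIntegral_congr_fun measurableSet_Ioi fun t ht => ?_
  rw [mem_Ioi] at ht
  show P.real _ = P.real _
  congr 1
  ext ω
  simp only [mem_ofPred_eq, lt_max_iff]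
  constructor
  · rintro (h | h) <;> linarith
  · intro h; left; linarith

lemma HH_pos_aux (hX : LevyH P X) (hpos : ∀ x : ℝ, 0 < P {ω | x < X 1 ω}) (y : ℝ) :
    0 < HH (P.map (fun ω => X 1 ω - 1)) y := by
  unfold HH
  rw [integral_map ((hX.meas 1).sub_const 1).aemeasurable
    (by exact Measurable.aestronglyMeasurable (by fun_prop))]
  have hi : Integrable (fun ω => max (X 1 ω - 1 - y) 0) P :=
    ((hX.int.sub (integrable_const 1)).sub (integrable_const y)).pos_part
  have hnn : (0 : Ω → ℝ) ≤ fun ω => max (X 1 ω - 1 - y) 0 := fun ω => le_max_right _ _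
  rw [integral_pos_iff_support_of_nonneg hnn hi]
  refine (hpos (1 + y)).trans_le (measure_mono ?_)
  intro ω hω
  rw [mem_ofPred_eq] at hω
  rw [Function.mem_support]
  exact (lt_max_of_lt_left (by linarith)).ne'

lemma levy_sup_asymp (hX : LevyH P X) (N q : ℝ → ℝ) (α : ℝ) (hα : 1 < α)
    (hpos : ∀ x : ℝ, 0 < P {ω | x < X 1 ω})
    (hRV : ∀ c : ℝ, 0 < c → Tendsto (fun x : ℝ =>
          (P {ω | c * x < X 1 ω}).toReal / (P {ω | x < X 1 ω}).toReal)
        atTop (nhds (c ^ (-α))))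
    (hq : ∀ u, q u = P.real {ω | ∃ t, 0 ≤ t ∧ u < X t ω - t})
    (hNq : ∀ u, N u ≤ q u)
    (he : ∀ ε : ℝ, 0 < ε → ε < 1 → ∀ᶠ u in atTop, (1 - ε) * q ((1 + ε) * u) ≤ N u) :
    Tendsto (fun u => N u / ((1 / (α - 1)) * u * (P {ω | u < X 1 ω}).toReal)) atTop (nhds 1) := by
  set μ := P.map (fun ω => X 1 ω - 1) with hμ
  set F : ℝ → ℝ := fun x => (P {ω | x < X 1 ω}).toReal with hF
  have hFa : Antitone F := by
    intro a b hab
    refine ENNReal.toReal_mono (measure_ne_top _ _) (measure_mono ?_)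
    intro ω hω
    exact lt_of_le_of_lt hab hω
  have hFp : ∀ x, 0 < F x := fun x => ENNReal.toReal_pos (hpos x).ne' (measure_ne_top _ _)
  have hm1 : Measurable (fun ω => X 1 ω - 1) := (hX.meas 1).sub_const 1
  have : IsProbabilityMeasure μ := Measure.isProbabilityMeasure_map hm1.aemeasurable
  have := nuX_prob hX
  have hint : Integrable (fun x : ℝ => x) μ := by
    rw [hμ, integrable_map_measure (by exact Measurable.aestronglyMeasurable (by fun_prop))
      hm1.aemeasurable]
    exact hX.int.sub (integrable_const 1)
  have hmean : ∫ x, x ∂μ = -1 := by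
    rw [hμ, integral_map hm1.aemeasurable (by exact Measurable.aestronglyMeasurable (by fun_prop)),
      integral_sub hX.int (integrable_const 1), hX.mean]
    simp
  have hfix : nuX P X = ((nuX P X).prod μ).map (fun z => max 0 (z.1 + z.2)) :=
    lindley_aux (incs X 1) (incs_meas hX 1) (incs_indep hX 1 one_pos) μ
      (fun i => incs_law hX 1 one_pos i) (incs_bdd hX)
  set H : ℝ → ℝ := fun y => HH μ (y - 1) with hH
  have hHe : ∀ y, H y = ∫ t in Ioi y, F t := fun y => layer_aux hX y
  have hHa : Antitone H := fun a b hab => HH_anti hint (by linarith)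
  have hHp : ∀ y, 0 < H y := fun y => HH_pos_aux hX hpos _
  have hR : ∀ c : ℝ, 0 < c → Tendsto (fun x => H (c * x) / H x) atTop (nhds (c ^ (1 - α))) := by
    intro c hc
    simp only [hHe]
    exact Hratio_aux F hFa hFp α hα hRV c hc
  set p : ℝ → ℝ := fun u => (nuX P X).real (Ioi u) with hp
  have hpe : ∀ u, p u = P.real {ω | ∃ n : ℕ, u < X n ω - n} := fun u => nuX_Ioi hX u
  have key : Tendsto (fun u => N u / H u) atTop (nhds 1) := by
    refine final_aux N q p H (1 - α) hHa hHp hR ?_ ?_ ?_ ?_ ?_ (Ioi_tendsto _) hNq he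
    · intro u
      rw [hpe, hq]
      refine measureReal_mono ?_
      rintro ω ⟨n, hn⟩
      exact ⟨n, Nat.cast_nonneg n, hn⟩
    · intro a b hab
      rw [hq, hq]
      refine measureReal_mono ?_
      rintro ω ⟨t, h0, ht⟩
      exact ⟨t, h0, lt_of_le_of_lt hab ht⟩
    · intro δ h0 h1
      obtain ⟨K, hK0, hK⟩ := otta_levy hX δ h0 h1
      refine ⟨K, hK0, fun u => ?_⟩
      rw [hpe, hq]
      exact hK u
    · refine iter_aux p H (fun x => measureReal_le_one) (fun x => measureReal_nonneg) hHa hHp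
        (1 - α) hR ?_
      intro r hr0 hr1 κ hκ
      filter_upwards [core_rec hint hmean hfix r hr0 hr1 κ hκ] with v hv
      refine hv.trans ?_
      have : HH μ (r ^ 2 * v) ≤ H (r ^ 2 * v) := HH_anti hint (by linarith)
      simp only [hp]
      linarith
    · intro u hu
      have := core_lower hint hmean hfix u hu
      simp only [hH, add_sub_cancel_right]
      exact this
  have hk := karamata_aux F hFa hFp α hα hRV
  have h2 := key.mul hk
  rw [mul_one] at h2
  refine h2.congr fun u => ?_
  rw [← hHe]
  have := (hHp u).ne'
  rw [div_mul_div_cancel₀ this]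

lemma Qe_law_aux (hX : LevyH P X) (Qe : Ω → ℝ) (hQm : Measurable Qe)
    (hQd : Measure.map Qe P
      = Measure.map (fun ω => ⨆ r : {r : ℝ // 0 ≤ r}, (X (r : ℝ) ω - (r : ℝ))) P) (u : ℝ) :
    P.real {ω | u < Qe ω} = P.real {ω | ∃ t, 0 ≤ t ∧ u < X t ω - t} := by
  have hprob : IsProbabilityMeasure (Measure.map Qe P) :=
    Measure.isProbabilityMeasure_map hQm.aemeasurable
  have hae : AEMeasurable (fun ω => ⨆ r : {r : ℝ // 0 ≤ r}, (X (r : ℝ) ω - (r : ℝ))) P := by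
    by_contra hc
    rw [Measure.map_of_not_aemeasurable hc] at hQd
    rw [hQd] at hprob
    exact IsProbabilityMeasure.ne_zero (0 : Measure ℝ) rfl
  have e1 : P {ω | u < Qe ω} = Measure.map Qe P (Ioi u) := by
    rw [Measure.map_apply hQm measurableSet_Ioi]; rfl
  rw [hQd, Measure.map_apply_of_aemeasurable hae measurableSet_Ioi] at e1
  rw [measureReal_def, e1, ← measureReal_def]
  refine measureReal_congr ?_
  filter_upwards [levy_bdd hX] with ω hω
  obtain ⟨B, hB⟩ := hω
  refine propext ?_
  show u < _ ↔ ∃ t, _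
  have : Nonempty {r : ℝ // 0 ≤ r} := ⟨⟨0, le_rfl⟩⟩
  rw [lt_ciSup_iff ⟨B, by rintro _ ⟨r, rfl⟩; exact hB r r.2⟩]
  constructor
  · rintro ⟨r, hr⟩; exact ⟨r, r.2, hr⟩
  · rintro ⟨t, h0, ht⟩; exact ⟨⟨t, h0⟩, ht⟩

lemma inf_upper_aux (hX : LevyH P X) (Qe : Ω → ℝ) (u T : ℝ) (hT : 0 < T) :
    P.real {ω | u < Qe ω + ⨅ s : Set.Icc (0:ℝ) T, (X (s : ℝ) ω - (s : ℝ))} ≤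
      P.real {ω | u < Qe ω} := by
  rw [measureReal_def, measureReal_def]
  refine ENNReal.toReal_mono (measure_ne_top _ _) (measure_mono_ae ?_)
  filter_upwards [hX.zero] with ω h0
  intro h
  have h : u < Qe ω + ⨅ s : Set.Icc (0:ℝ) T, (X (s : ℝ) ω - (s : ℝ)) := h
  show u < Qe ω
  have : ⨅ s : Set.Icc (0:ℝ) T, (X (s : ℝ) ω - (s : ℝ)) ≤ 0 := by
    by_cases hb : BddBelow (range fun s : Set.Icc (0:ℝ) T => X (s : ℝ) ω - (s : ℝ))
    · refine (ciInf_le hb ⟨0, le_rfl, hT.le⟩).trans ?_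
      simp [h0]
    · rw [Real.iInf_of_not_bddBelow hb]
  linarith

/-- the path event that `-X(t) - t` stays below `b` on dyadics -/
def pathC (b : ℝ) : Set (ℝ → ℝ) :=
  {f | ∀ n k : ℕ, - f ((k : ℝ) * (1 / 2 ^ n)) - (k : ℝ) * (1 / 2 ^ n) ≤ b}

lemma pathC_meas (b : ℝ) : MeasurableSet (pathC b) := by
  unfold pathC
  simp only [setOf_forall]
  refine MeasurableSet.iInter fun n => MeasurableSet.iInter fun k => ?_
  exact measurableSet_le (((measurable_pi_apply _).neg).sub_const _) measurable_const

lemma pathC_tendsto (hX : LevyH P X) :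
    Tendsto (fun n : ℕ => P.real ((fun ω => fun t : ℝ => X t ω) ⁻¹' pathC n)) atTop (nhds 1) := by
  have hM : Measurable (fun ω => fun t : ℝ => X t ω) := measurable_pi_lambda _ hX.meas
  have hmono : Monotone (fun n : ℕ => (fun ω => fun t : ℝ => X t ω) ⁻¹' pathC n) := by
    intro a b hab ω hω n k
    have : (a : ℝ) ≤ b := by exact_mod_cast hab
    exact (hω n k).trans this
  have h1 : P (⋃ n : ℕ, (fun ω => fun t : ℝ => X t ω) ⁻¹' pathC n) = 1 := by
    have hall : ∀ᵐ ω ∂P, ω ∈ ⋃ n : ℕ, (fun ω => fun t : ℝ => X t ω) ⁻¹' pathC n := by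
      filter_upwards [levy_bdd hX.neg] with ω hω
      obtain ⟨B, hB⟩ := hω
      obtain ⟨m, hm⟩ := exists_nat_ge B
      exact mem_iUnion.2 ⟨m, fun n k => (hB _ (by positivity)).trans hm⟩
    rw [← measure_univ (μ := P)]
    exact measure_congr (eventuallyEq_univ.2 hall)
  have h2 := tendsto_measure_iUnion_atTop (μ := P) hmono
  rw [h1] at h2
  exact (ENNReal.tendsto_toReal ENNReal.one_ne_top).comp h2

lemma inf_lower_aux (hX : LevyH P X) (Qe : Ω → ℝ) (hQm : Measurable Qe)
    (hQi : IndepFun Qe (fun ω => fun t : ℝ => X t ω) P) (u T b : ℝ) (hT : 0 < T) :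
    P.real {ω | u + (b + 2 * T) < Qe ω} * P.real ((fun ω => fun t : ℝ => X t ω) ⁻¹' pathC b) ≤
    P.real {ω | u < Qe ω + ⨅ s : Set.Icc (0:ℝ) T, (X (s : ℝ) ω - (s : ℝ))} := by
  have hi := hQi.measure_inter_preimage_eq_mul (Ioi (u + (b + 2 * T))) (pathC b)
    measurableSet_Ioi (pathC_meas b)
  have e : P.real {ω | u + (b + 2 * T) < Qe ω} * P.real ((fun ω => fun t : ℝ => X t ω) ⁻¹' pathC b)
      = (P (Qe ⁻¹' Ioi (u + (b + 2 * T)) ∩ (fun ω => fun t : ℝ => X t ω) ⁻¹' pathC b)).toReal := by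
    rw [hi, ENNReal.toReal_mul]; rfl
  rw [e, measureReal_def]
  refine ENNReal.toReal_mono (measure_ne_top _ _) (measure_mono_ae ?_)
  filter_upwards [hX.path] with ω hω
  rintro ⟨h1, h2⟩
  have h1 : u + (b + 2 * T) < Qe ω := h1
  show u < Qe ω + ⨅ s : Set.Icc (0:ℝ) T, (X (s : ℝ) ω - (s : ℝ))
  have : Nonempty (Set.Icc (0:ℝ) T) := ⟨⟨0, le_rfl, hT.le⟩⟩
  have : -(b + 2 * T) ≤ ⨅ s : Set.Icc (0:ℝ) T, (X (s : ℝ) ω - (s : ℝ)) := by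
    refine le_ciInf fun s => ?_
    by_contra hc
    have hs := s.2.2
    obtain ⟨n, k, hk⟩ := rc_aux (fun s => - X s ω - s) s b s.2.1
      (((hω s s.2.1).1.neg).sub continuousWithinAt_id) (by linarith)
    exact absurd (h2 n k) (not_le.2 hk)
  linarith

end assembly

/-- **Corollary 3.5, case `T_u = o(u)`**. -/
theorem inf_reflected_levy_heavy_tailed_small_window
    {Ω : Type*} [MeasureSpace Ω] [IsProbabilityMeasure (ℙ : Measure Ω)]
    (X : ℝ → Ω → ℝ)
    (hmeas : ∀ t : ℝ, Measurable (X t))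
    (hX0 : ∀ᵐ ω ∂ℙ, X 0 ω = 0)
    (hpath : ∀ᵐ ω ∂ℙ, ∀ t : ℝ, 0 ≤ t →
      ContinuousWithinAt (fun s => X s ω) (Set.Ici t) t ∧
      (0 < t → ∃ l : ℝ, Tendsto (fun s => X s ω) (nhdsWithin t (Set.Iio t)) (nhds l)))
    (hstat : ∀ s t : ℝ, 0 ≤ s → s ≤ t →
      Measure.map (fun ω => X t ω - X s ω) ℙ = Measure.map (X (t - s)) ℙ)
    (hincr : ∀ (n : ℕ) (t : Fin (n + 1) → ℝ), (∀ i, 0 ≤ t i) → StrictMono t →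
      iIndepFun
        (fun i : Fin n => fun ω => X (t i.succ) ω - X (t i.castSucc) ω) ℙ)
    (hint : Integrable (X 1) ℙ)
    (hmean : ∫ ω, X 1 ω ∂ℙ = 0)
    (Qe : Ω → ℝ) (hQe_meas : Measurable Qe)
    (hQe_dist : Measure.map Qe ℙ
      = Measure.map (fun ω => ⨆ r : {r : ℝ // 0 ≤ r}, (X (r : ℝ) ω - (r : ℝ))) ℙ)
    (hQe_indep : IndepFun Qe (fun ω => fun t : ℝ => X t ω) ℙ)
    (α : ℝ) (hα : 1 < α)
    (htail_pos : ∀ x : ℝ, 0 < ℙ {ω | x < X 1 ω})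
    (hRV : ∀ c : ℝ, 0 < c →
      Tendsto (fun x : ℝ =>
          (ℙ {ω | c * x < X 1 ω}).toReal / (ℙ {ω | x < X 1 ω}).toReal)
        atTop (nhds (c ^ (-α))))
    (hbal : α < 2 → ∃ ρ : ℝ, 0 ≤ ρ ∧
      Tendsto (fun x : ℝ =>
          (ℙ {ω | X 1 ω < -x}).toReal / (ℙ {ω | x < X 1 ω}).toReal)
        atTop (nhds ρ))
    (T : ℝ → ℝ) (hT_pos : ∀ u : ℝ, 0 < u → 0 < T u)
    (hTu : Tendsto (fun u : ℝ => T u / u) atTop (nhds 0)) :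
    Tendsto (fun u : ℝ =>
        (ℙ {ω | u < Qe ω + ⨅ s : Set.Icc (0:ℝ) (T u), (X (s : ℝ) ω - (s : ℝ))}).toReal
          / ((1 / (α - 1)) * u * (ℙ {ω | u < X 1 ω}).toReal))
      atTop (nhds 1) := by
  have hX : LevyH (ℙ : Measure Ω) X := ⟨hmeas, hX0, hpath, hstat, hincr, hint, hmean⟩
  have hlaw := Qe_law_aux hX Qe hQe_meas hQe_dist
  set N : ℝ → ℝ := fun u => if 0 < u then
    (ℙ : Measure Ω).real {ω | u < Qe ω + ⨅ s : Set.Icc (0:ℝ) (T u), (X (s : ℝ) ω - (s : ℝ))} else 0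
    with hN
  have key := levy_sup_asymp hX N (fun u => (ℙ : Measure Ω).real {ω | u < Qe ω}) α hα htail_pos hRV
    hlaw ?_ ?_
  · refine key.congr' ?_
    filter_upwards [eventually_gt_atTop 0] with u hu
    simp only [hN, if_pos hu]
    rfl
  · intro u
    simp only [hN]
    split_ifs with hu
    · exact inf_upper_aux hX Qe u (T u) (hT_pos u hu)
    · exact measureReal_nonneg
  · intro ε h0 h1
    obtain ⟨m, hm⟩ := ((pathC_tendsto hX).eventually
      (lt_mem_nhds (show 1 - ε < 1 by linarith))).exists
    filter_upwards [eventually_gt_atTop 0, eventually_ge_atTop (2 * m / ε),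
      hTu.eventually (gt_mem_nhds (show (0:ℝ) < ε / 4 by linarith))] with u hu a1 a2
    simp only [hN, if_pos hu]
    refine le_trans ?_ (inf_lower_aux hX Qe hQe_meas hQe_indep u (T u) m (hT_pos u hu))
    rw [mul_comm]
    refine mul_le_mul (measureReal_mono ?_) hm.le (by linarith) measureReal_nonneg
    intro ω hω
    rw [mem_ofPred_eq] at hω ⊢
    rw [div_le_iff₀ h0] at a1
    rw [div_lt_iff₀ hu] at a2
    nlinarith
end

section
/- Suppose X satisfies Assumption 2. Then (1/u) · log P(Q_e > u) → −ϑ* as u → ∞. -/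
open MeasureTheory ProbabilityTheory Filter Set

theorem aux_maximal {Ω : Type*} [MeasurableSpace Ω] (μ : Measure Ω) [IsProbabilityMeasure μ]
    (W : ℕ → Ω → ℝ) (hW : ∀ i, Measurable (W i)) (hind : iIndepFun W μ) (θ : ℝ) (hθ : 0 < θ)
    (h1 : ∀ i, ∫⁻ ω, ENNReal.ofReal (Real.exp (θ * W i ω)) ∂μ = 1) (u : ℝ) (hu : 0 ≤ u) (n : ℕ) :
    μ {ω | ∃ k ≤ n, u < ∑ i ∈ Finset.range k, W i ω} ≤ ENNReal.ofReal (Real.exp (-(θ * u))) := by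
  classical
  set c : ENNReal := ENNReal.ofReal (Real.exp (θ * u)) with hc
  let H : ℕ → Set Ω := fun n => {ω | ∃ k ≤ n, u < ∑ i ∈ Finset.range k, W i ω}
  have hSm : ∀ k, Measurable (fun ω => ∑ i ∈ Finset.range k, W i ω) := fun k =>
    Finset.measurable_fun_sum _ (fun i _ => hW i)
  have hHm : ∀ n, MeasurableSet (H n) := by
    intro n
    have : H n = ⋃ k ∈ Finset.range (n+1), {ω | u < ∑ i ∈ Finset.range k, W i ω} := by
      ext ω; simp [H]
    rw [this]
    exact Finset.measurableSet_biUnion _ (fun k _ => measurableSet_lt measurable_const (hSm k))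
  let E : ℕ → Ω → ENNReal := fun k ω => ENNReal.ofReal (Real.exp (θ * ∑ i ∈ Finset.range k, W i ω))
  have hEm : ∀ k, Measurable (E k) := fun k =>
    ((hSm k).const_mul θ).exp.ennreal_ofReal
  have hindep : ∀ k, IndepFun ((H k)ᶜ.indicator (E k))
      (fun ω => ENNReal.ofReal (Real.exp (θ * W k ω))) μ := by
    intro k
    have hd : Disjoint (Finset.range k) {k} := by simp
    have h := hind.indepFun_finset (Finset.range k) {k} hd hW
    let ext : (Finset.range k → ℝ) → ℕ → ℝ := fun w i => if h : i ∈ Finset.range k then w ⟨i, h⟩ else 0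
    have hext : ∀ i, Measurable (fun w => ext w i) := by
      intro i
      by_cases h : i ∈ Finset.range k
      · simp only [ext, h, dite_true]; exact measurable_pi_apply _
      · simp only [ext, h, dite_false]; exact measurable_const
    have hxs : ∀ j, Measurable (fun w => ∑ i ∈ Finset.range j, ext w i) := fun j =>
      Finset.measurable_fun_sum _ (fun i _ => hext i)
    let B : Set (Finset.range k → ℝ) := ⋃ j ∈ Finset.range (k+1), {w | u < ∑ i ∈ Finset.range j, ext w i}
    have hB : MeasurableSet B :=
      Finset.measurableSet_biUnion _ (fun k _ => measurableSet_lt measurable_const (hxs k))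
    let G : (Finset.range k → ℝ) → ENNReal := Bᶜ.indicator
      (fun w => ENNReal.ofReal (Real.exp (θ * ∑ i ∈ Finset.range k, ext w i)))
    have hG : Measurable G := Measurable.indicator (((hxs k).const_mul θ).exp.ennreal_ofReal) hB.compl
    let K : (({k} : Finset ℕ) → ℝ) → ENNReal := fun w =>
      ENNReal.ofReal (Real.exp (θ * w ⟨k, by simp⟩))
    have hK : Measurable K := by
      apply Measurable.ennreal_ofReal
      apply Measurable.exp
      exact (measurable_pi_apply (X := fun _ : ({k} : Finset ℕ) => ℝ) ⟨k, by simp⟩).const_mul θ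
    have := h.comp hG hK
    have h2 : ((H k)ᶜ.indicator (E k)) = G ∘ (fun ω (i : Finset.range k) => W i ω) := by
     ext ω
     have hs : ∀ j ≤ k, ∑ i ∈ Finset.range j, ext (fun i => W i ω) i = ∑ i ∈ Finset.range j, W i ω := by
       intro j hj
       apply Finset.sum_congr rfl
       intro i hi
       have : i < k := lt_of_lt_of_le (Finset.mem_range.1 hi) hj
       simp [ext, this]
     have hmem : (fun i : Finset.range k => W i ω) ∈ B ↔ ω ∈ H k := by
       simp only [B, H, mem_iUnion, mem_ofPred_eq, Finset.mem_range, Nat.lt_succ_iff]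
       constructor
       · rintro ⟨j, hj, h⟩; exact ⟨j, hj, by rwa [hs j hj] at h⟩
       · rintro ⟨j, hj, h⟩; exact ⟨j, hj, by rwa [hs j hj]⟩
     simp only [Function.comp, G, indicator, mem_compl_iff, hmem, E, hs k le_rfl]
    rw [h2]
    exact this
  have key : ∀ k, c * μ (H k) + ∫⁻ ω, (H k)ᶜ.indicator (E k) ω ∂μ ≤ 1 := by
    intro k
    induction k with
    | zero =>
      have : H 0 = ∅ := by
        ext ω; simp [H, hu]
      simp [this, E]
    | succ k ih =>
      refine le_trans ?_ ih
      have e1 : ∫⁻ ω, (H k)ᶜ.indicator (E k) ω ∂μ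
          = ∫⁻ ω, (H k)ᶜ.indicator (E k) ω * ENNReal.ofReal (Real.exp (θ * W k ω)) ∂μ := by
        rw [lintegral_mul_eq_lintegral_mul_lintegral_of_indepFun''
          ((hEm k).indicator (hHm k).compl).aemeasurable
          ((hW k).const_mul θ).exp.ennreal_ofReal.aemeasurable (hindep k), h1, mul_one]
      have e2 : ∀ k, c * μ (H k) = ∫⁻ ω, (H k).indicator (fun _ => c) ω ∂μ := by
        intro k; rw [lintegral_indicator_const (hHm k)]
      rw [e1, e2, e2, ← lintegral_add_left (measurable_const.indicator (hHm _)),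
        ← lintegral_add_left (measurable_const.indicator (hHm _))]
      apply lintegral_mono
      intro ω
      have hsucc : ω ∈ H (k+1) ↔ ω ∈ H k ∨ u < ∑ i ∈ Finset.range (k+1), W i ω := by
        simp only [H, mem_ofPred_eq]
        constructor
        · rintro ⟨j, hj, h⟩
          rcases Nat.le_succ_iff.1 hj with h' | h'
          · exact Or.inl ⟨j, h', h⟩
          · right; subst h'; exact h
        · rintro (⟨j, hj, h⟩ | h)
          · exact ⟨j, by omega, h⟩
          · exact ⟨k+1, le_rfl, h⟩
      have hE : E (k+1) ω = E k ω * ENNReal.ofReal (Real.exp (θ * W k ω)) := by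
        simp only [E]
        rw [← ENNReal.ofReal_mul (Real.exp_pos _).le, ← Real.exp_add, Finset.sum_range_succ, mul_add]
      by_cases hk : ω ∈ H k
      · have : ω ∈ H (k+1) := hsucc.2 (Or.inl hk)
        simp [hk, this]
      · by_cases hk' : ω ∈ H (k+1)
        · have hlt : u < ∑ i ∈ Finset.range (k+1), W i ω := by tauto
          simp only [hk, hk', indicator, mem_compl_iff, not_true, not_false_eq_true, if_true, if_false, add_zero, zero_add]
          rw [← hE]
          apply ENNReal.ofReal_le_ofReal
          apply Real.exp_le_exp.2
          exact mul_le_mul_of_nonneg_left hlt.le hθ.le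
        · simp only [hk, hk', indicator, mem_compl_iff, not_false_eq_true, if_true, if_false, zero_add]
          rw [hE]
  have h2 : c * μ (H n) ≤ 1 := le_trans le_self_add (key n)
  have h3 : ENNReal.ofReal (Real.exp (-(θ * u))) * c = 1 := by
    rw [hc, ← ENNReal.ofReal_mul (Real.exp_pos _).le, ← Real.exp_add]; simp
  calc μ (H n) = ENNReal.ofReal (Real.exp (-(θ * u))) * c * μ (H n) := by rw [h3, one_mul]
    _ = ENNReal.ofReal (Real.exp (-(θ * u))) * (c * μ (H n)) := by rw [mul_assoc]
    _ ≤ ENNReal.ofReal (Real.exp (-(θ * u))) * 1 := by gcongr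
    _ = _ := mul_one _

theorem aux_step {Ω : Type*} [MeasurableSpace Ω] (μ : Measure Ω) [IsProbabilityMeasure μ]
    (S : Ω → ℝ) (hS : Measurable S) (ϑ δ u v : ℝ) (hϑ : 0 < ϑ) (hδ : 0 < δ)
    (h0 : Integrable (fun ω => Real.exp (ϑ * S ω)) μ)
    (h1 : Integrable (fun ω => Real.exp ((ϑ + δ) * S ω)) μ)
    (h2 : Integrable (fun ω => Real.exp ((ϑ - δ) * S ω)) μ) :
    mgf S μ ϑ ≤ Real.exp (ϑ * v) * μ.real {ω | u < S ω}
      + Real.exp (-δ * v) * mgf S μ (ϑ + δ) + Real.exp (δ * u) * mgf S μ (ϑ - δ) := by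
  have hm : MeasurableSet {ω | u < S ω} := measurableSet_lt measurable_const hS
  have hi : Integrable ({ω | u < S ω}.indicator (fun _ => Real.exp (ϑ * v))) μ :=
    (integrable_const _).indicator hm
  have e : Real.exp (ϑ * v) * μ.real {ω | u < S ω}
      = ∫ ω, {ω | u < S ω}.indicator (fun _ => Real.exp (ϑ * v)) ω ∂μ := by
    rw [integral_indicator_const _ hm, smul_eq_mul, mul_comm]
  have hi2 : Integrable (fun ω => {ω | u < S ω}.indicator (fun _ => Real.exp (ϑ * v)) ω
      + Real.exp (-δ * v) * Real.exp ((ϑ + δ) * S ω)) μ := hi.add (h1.const_mul _)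
  unfold mgf
  rw [e, ← integral_const_mul, ← integral_const_mul, ← integral_add hi (h1.const_mul _),
    ← integral_add hi2 (h2.const_mul _)]
  apply integral_mono h0 (hi2.add (h2.const_mul _))
  intro ω
  show Real.exp (ϑ * S ω) ≤ {ω | u < S ω}.indicator (fun _ => Real.exp (ϑ * v)) ω
      + Real.exp (-δ * v) * Real.exp ((ϑ + δ) * S ω) + Real.exp (δ * u) * Real.exp ((ϑ - δ) * S ω)
  rw [← Real.exp_add, ← Real.exp_add]
  have p1 := Real.exp_pos (-δ * v + (ϑ + δ) * S ω)
  have p2 := Real.exp_pos (δ * u + (ϑ - δ) * S ω)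
  have p0 : 0 ≤ {ω | u < S ω}.indicator (fun _ => Real.exp (ϑ * v)) ω :=
    indicator_nonneg (fun _ _ => (Real.exp_pos _).le) _
  by_cases hu : u < S ω
  · by_cases hv : S ω ≤ v
    · have : {ω | u < S ω}.indicator (fun _ => Real.exp (ϑ * v)) ω = Real.exp (ϑ * v) :=
        indicator_of_mem (by exact hu) _
      have : Real.exp (ϑ * S ω) ≤ Real.exp (ϑ * v) :=
        Real.exp_le_exp.2 (mul_le_mul_of_nonneg_left hv hϑ.le)
      linarith
    · have : Real.exp (ϑ * S ω) ≤ Real.exp (-δ * v + (ϑ + δ) * S ω) :=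
        Real.exp_le_exp.2 (by nlinarith)
      linarith
  · have : Real.exp (ϑ * S ω) ≤ Real.exp (δ * u + (ϑ - δ) * S ω) :=
        Real.exp_le_exp.2 (by nlinarith)
    linarith

theorem aux_lower {Ω : Type*} [MeasurableSpace Ω] (μ : Measure Ω) [IsProbabilityMeasure μ]
    (W : ℕ → Ω → ℝ) (hW : ∀ i, Measurable (W i)) (hind : iIndepFun W μ)
    (hid : ∀ i, IdentDistrib (W i) (W 0) μ μ) (ϑ m : ℝ) (hϑ : 0 < ϑ) (hm : 0 < m)
    (hin : ϑ ∈ interior (integrableExpSet (W 0) μ)) (h1 : mgf (W 0) μ ϑ = 1)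
    (hder : HasDerivAt (mgf (W 0) μ) m ϑ) (ε : ℝ) (hε : 0 < ε) (hε1 : ε ≤ 1) :
    ∀ᶠ u in atTop, ∃ n : ℕ, (1 / 2) * Real.exp (-(ϑ * ((1 + 3 * ε) * u)))
      ≤ μ.real {ω | u < ∑ i ∈ Finset.range n, W i ω} := by
  obtain ⟨δ, hδ, i1, i2, b1, b2⟩ : ∃ δ > 0, ϑ + δ ∈ integrableExpSet (W 0) μ ∧
      ϑ - δ ∈ integrableExpSet (W 0) μ ∧
      mgf (W 0) μ (ϑ + δ) ≤ Real.exp (δ * m * (1 + ε / 4)) ∧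
      mgf (W 0) μ (ϑ - δ) ≤ Real.exp (-(δ * m * (1 - ε / 4))) := by
    have hl := hder.isLittleO.def (show 0 < m * (ε / 4) by positivity)
    have hn := mem_interior_iff_mem_nhds.1 hin
    obtain ⟨r, hr, hb⟩ := Metric.eventually_nhds_iff.1 (hl.and hn)
    have a1 := hb (y := ϑ + r / 2) (by simp [abs_of_pos hr]; linarith)
    have a2 := hb (y := ϑ - r / 2) (by simp [abs_of_pos hr]; linarith)
    refine ⟨r / 2, by positivity, a1.2, a2.2, ?_, ?_⟩
    · have := a1.1
      simp only [h1, Real.norm_eq_abs, smul_eq_mul, add_sub_cancel_left, abs_of_pos (half_pos hr)] at this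
      have := (abs_le.1 this).2
      refine le_trans ?_ (Real.add_one_le_exp _)
      nlinarith
    · have := a2.1
      have e : ϑ - r / 2 - ϑ = -(r / 2) := by ring
      simp only [h1, Real.norm_eq_abs, smul_eq_mul, e, abs_neg, abs_of_pos (half_pos hr)] at this
      have := (abs_le.1 this).2
      refine le_trans ?_ (Real.add_one_le_exp _)
      nlinarith
  filter_upwards [eventually_ge_atTop ((6 + 4 * δ * m) / (δ * ε)), eventually_gt_atTop 0] with u hu hu0
  rw [div_le_iff₀ (by positivity)] at hu
  let n := ⌈u * (1 + ε) / m⌉₊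
  refine ⟨n, ?_⟩
  have n1 : u * (1 + ε) ≤ n * m := by
    have := Nat.le_ceil (u * (1 + ε) / m)
    rwa [div_le_iff₀ hm] at this
  have n2 : n * m ≤ u * (1 + ε) + m := by
    have : (n : ℝ) < u * (1 + ε) / m + 1 := Nat.ceil_lt_add_one (by positivity)
    have := mul_lt_mul_of_pos_right this hm
    rw [add_mul, div_mul_cancel₀ _ hm.ne'] at this
    linarith
  have hint : ∀ t, t ∈ integrableExpSet (W 0) μ →
      Integrable (fun ω => Real.exp (t * ∑ i ∈ Finset.range n, W i ω)) μ := by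
    intro t ht
    have := hind.integrable_exp_mul_sum (t := t) hW (s := Finset.range n) (fun i _ => by
      have := (hid i).symm.comp (u := fun x => Real.exp (t * x)) (by fun_prop)
      exact this.integrable_iff.1 ht)
    simpa using this
  have hmgf : ∀ t, mgf (fun ω => ∑ i ∈ Finset.range n, W i ω) μ t = mgf (W 0) μ t ^ n := by
    intro t
    have := hind.mgf_sum (t := t) hW (Finset.range n)
    rw [Finset.prod_congr rfl (fun i _ => mgf_congr_of_identDistrib _ _ (hid i) t)] at this
    simp only [Finset.prod_const, Finset.card_range] at this
    rw [← this]
    congr 1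
    ext ω; simp
  have hs := aux_step μ (fun ω => ∑ i ∈ Finset.range n, W i ω)
    (Finset.measurable_fun_sum _ (fun i _ => hW i)) ϑ δ u ((1 + 3 * ε) * u) hϑ hδ
    (hint _ (interior_subset hin)) (hint _ i1) (hint _ i2)
  rw [hmgf, hmgf, hmgf, h1, one_pow] at hs
  have q3 : Real.exp (-3) ≤ 1 / 4 := by
    rw [Real.exp_neg, ← one_div]
    exact one_div_le_one_div_of_le (by norm_num) (by linarith [Real.add_one_le_exp 3])
  have t1 : Real.exp (-δ * ((1 + 3 * ε) * u)) * mgf (W 0) μ (ϑ + δ) ^ n ≤ 1 / 4 := by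
    refine le_trans ?_ q3
    calc _ ≤ Real.exp (-δ * ((1 + 3 * ε) * u)) * Real.exp (δ * m * (1 + ε / 4)) ^ n := by
          gcongr
          exact mgf_nonneg
      _ = Real.exp (-δ * ((1 + 3 * ε) * u) + δ * (1 + ε / 4) * (n * m)) := by
          rw [← Real.exp_nat_mul, ← Real.exp_add]; ring_nf
      _ ≤ _ := by
          apply Real.exp_le_exp.2
          have : δ * (1 + ε / 4) * (n * m) ≤ δ * (1 + ε / 4) * (u * (1 + ε) + m) := by gcongr
          have k1 : 0 ≤ δ * ε * u * (1 - ε) := by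
            have : 0 ≤ 1 - ε := by linarith
            positivity
          have k2 : 0 ≤ δ * m * (1 - ε) := by
            have : 0 ≤ 1 - ε := by linarith
            positivity
          have k3 : 0 < δ * m := by positivity
          nlinarith
  have t2 : Real.exp (δ * u) * mgf (W 0) μ (ϑ - δ) ^ n ≤ 1 / 4 := by
    refine le_trans ?_ q3
    calc _ ≤ Real.exp (δ * u) * Real.exp (-(δ * m * (1 - ε / 4))) ^ n := by
          gcongr
          exact mgf_nonneg
      _ = Real.exp (δ * u - δ * (1 - ε / 4) * (n * m)) := by
          rw [← Real.exp_nat_mul, ← Real.exp_add]; ring_nf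
      _ ≤ _ := by
          apply Real.exp_le_exp.2
          have : 0 ≤ 1 - ε / 4 := by linarith
          have : δ * (1 - ε / 4) * (u * (1 + ε)) ≤ δ * (1 - ε / 4) * (n * m) := by gcongr
          have k1 : 0 ≤ δ * ε * u * (1 - ε) := by
            have : 0 ≤ 1 - ε := by linarith
            positivity
          have k3 : 0 < δ * m := by positivity
          nlinarith
  rw [Real.exp_neg, ← div_eq_mul_inv, div_le_iff₀ (Real.exp_pos _), mul_comm]
  linarith

theorem aux_deriv_pos {Ω : Type*} [MeasurableSpace Ω] (μ : Measure Ω) [IsProbabilityMeasure μ]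
    (Z : Ω → ℝ) (ϑ : ℝ) (hϑ : 0 < ϑ)
    (hin : ϑ ∈ interior (integrableExpSet Z μ)) (h1 : mgf Z μ ϑ = 1)
    (hZ : ∫ ω, Z ω ∂μ ≠ 0) : 0 < ∫ ω, Z ω * Real.exp (ϑ * Z ω) ∂μ := by
  have hi : Integrable (fun ω => Z ω * Real.exp (ϑ * Z ω)) μ := by
    simpa using integrable_pow_mul_exp_of_mem_interior_integrableExpSet hin 1
  have he : Integrable (fun ω => Real.exp (ϑ * Z ω)) μ :=
    integrable_of_mem_integrableExpSet (interior_subset hin)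
  have hg : Integrable (fun ω => 1 - Real.exp (ϑ * Z ω) + ϑ * (Z ω * Real.exp (ϑ * Z ω))) μ :=
    ((integrable_const _).sub he).add (hi.const_mul _)
  have hn : ∀ ω, 0 ≤ 1 - Real.exp (ϑ * Z ω) + ϑ * (Z ω * Real.exp (ϑ * Z ω)) ∧
      (1 - Real.exp (ϑ * Z ω) + ϑ * (Z ω * Real.exp (ϑ * Z ω)) = 0 → Z ω = 0) := by
    intro ω
    have e : Real.exp (ϑ * Z ω) * Real.exp (-(ϑ * Z ω)) = 1 := by
      rw [← Real.exp_add]; simp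
    have p := Real.exp_pos (ϑ * Z ω)
    constructor
    · nlinarith [Real.add_one_le_exp (-(ϑ * Z ω))]
    · intro h
      by_contra hz
      have := Real.add_one_lt_exp (x := -(ϑ * Z ω)) (by simp [hϑ.ne', hz])
      nlinarith
  have hint : ∫ ω, (1 - Real.exp (ϑ * Z ω) + ϑ * (Z ω * Real.exp (ϑ * Z ω))) ∂μ
      = ϑ * ∫ ω, Z ω * Real.exp (ϑ * Z ω) ∂μ := by
    have hsub : Integrable (fun ω => 1 - Real.exp (ϑ * Z ω)) μ := (integrable_const _).sub he
    rw [integral_add hsub (hi.const_mul _), integral_sub (integrable_const _) he,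
      integral_const_mul]
    unfold mgf at h1
    rw [h1]; simp
  have hpos : 0 < ∫ ω, (1 - Real.exp (ϑ * Z ω) + ϑ * (Z ω * Real.exp (ϑ * Z ω))) ∂μ := by
    refine lt_of_le_of_ne (integral_nonneg (fun ω => (hn ω).1)) (fun h => hZ ?_)
    have := (integral_eq_zero_iff_of_nonneg (fun ω => (hn ω).1) hg).1 h.symm
    rw [integral_eq_zero_of_ae]
    filter_upwards [this] with ω hω
    exact (hn ω).2 hω
  rw [hint] at hpos
  exact (mul_pos_iff_of_pos_left hϑ).1 hpos

theorem aux_limit (p : ℝ → ℝ) (ϑ : ℝ) (hϑ : 0 < ϑ) (hup : ∀ u, 0 ≤ u → p u ≤ Real.exp (-(ϑ * u)))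
    (hlow : ∀ ε : ℝ, 0 < ε → ε ≤ 1 →
      ∀ᶠ u in atTop, (1 / 2) * Real.exp (-(ϑ * ((1 + 3 * ε) * u))) ≤ p u) :
    Tendsto (fun u => Real.log (p u) / u) atTop (nhds (-ϑ)) := by
  rw [Metric.tendsto_nhds]
  intro η hη
  have hε : 0 < min 1 (η / (6 * ϑ)) := by positivity
  have hε2 : min 1 (η / (6 * ϑ)) * (6 * ϑ) ≤ η := by
    rw [← le_div_iff₀ (by positivity)]; exact min_le_right _ _
  filter_upwards [hlow _ hε (min_le_left _ _), eventually_gt_atTop 0,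
    eventually_gt_atTop (2 * Real.log 2 / η)] with u h1 h0 h2
  set ε := min 1 (η / (6 * ϑ))
  have hp : 0 < p u := lt_of_lt_of_le (by positivity) h1
  have l1 := Real.log_le_log hp (hup u h0.le)
  have l2 := Real.log_le_log (by positivity) h1
  rw [Real.log_exp] at l1
  rw [Real.log_mul (by norm_num) (Real.exp_pos _).ne', Real.log_exp, one_div, Real.log_inv] at l2
  rw [div_lt_iff₀ hη] at h2
  rw [Real.dist_eq, abs_lt]
  have e : Real.log (p u) / u - -ϑ = (Real.log (p u) + ϑ * u) / u := by field_simp; ring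
  rw [e, lt_div_iff₀ h0, div_lt_iff₀ h0]
  constructor
  · nlinarith
  · nlinarith

theorem aux_indep {Ω : Type*} [MeasurableSpace Ω] (μ : Measure Ω) [IsProbabilityMeasure μ]
    (X : ℝ → Ω → ℝ)
    (hincr : ∀ (n : ℕ) (t : Fin (n + 1) → ℝ), (∀ i, 0 ≤ t i) → StrictMono t →
      iIndepFun
        (fun i : Fin n => fun ω => X (t i.succ) ω - X (t i.castSucc) ω) μ)
    (h : ℝ) (hh : 0 < h) :
    iIndepFun (fun (i : ℕ) ω => X (((i + 1 : ℕ) : ℝ) * h) ω - X ((i : ℝ) * h) ω - h) μ := by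
  have key : iIndepFun (fun (i : ℕ) ω => X (((i + 1 : ℕ) : ℝ) * h) ω - X ((i : ℝ) * h) ω) μ := by
    refine iIndepFun_iff_finset.2 fun s ↦ ?_
    obtain rfl | hs := s.eq_empty_or_nonempty
    · exact iIndepFun.of_subsingleton
    · let g (x : s) : Fin (s.max' hs + 1) := ⟨x.1, Nat.lt_add_one_of_le (s.le_max' x.1 x.2)⟩
      refine iIndepFun.precomp (g := g) ?_ (hincr (s.max' hs + 1) (fun m ↦ ((m : ℕ) : ℝ) * h) ?_ ?_)
      · intro a b hab
        exact Subtype.ext (Fin.mk.inj_iff.1 hab)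
      · intro i; positivity
      · intro a b hab
        have : ((a : ℕ) : ℝ) < (b : ℕ) := by exact_mod_cast hab
        exact mul_lt_mul_of_pos_right this hh
  exact key.comp (fun _ x => x - h) (fun _ => by fun_prop)

theorem aux_sum (x : ℝ → ℝ) (h : ℝ) (k : ℕ) :
    ∑ i ∈ Finset.range k, (x (((i + 1 : ℕ) : ℝ) * h) - x ((i : ℝ) * h) - h)
      = x (k * h) - x 0 - k * h := by
  induction k with
  | zero => simp
  | succ k ih => rw [Finset.sum_range_succ, ih]; push_cast; ring

theorem aux_lint {Ω : Type*} [MeasurableSpace Ω] (μ : Measure Ω) [IsProbabilityMeasure μ]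
    (W : ℕ → Ω → ℝ) (hW : ∀ i, Measurable (W i)) (hind : iIndepFun W μ)
    (hid : ∀ i, IdentDistrib (W i) (W 0) μ μ) (ϑ : ℝ) (N : ℕ) (hN : N ≠ 0)
    (h1 : ∫⁻ ω, ENNReal.ofReal (Real.exp (ϑ * ∑ i ∈ Finset.range N, W i ω)) ∂μ = 1) (i : ℕ) :
    ∫⁻ ω, ENNReal.ofReal (Real.exp (ϑ * W i ω)) ∂μ = 1 := by
  have hm : Measurable (fun x : ℝ => ENNReal.ofReal (Real.exp (ϑ * x))) := by fun_prop
  have hc : ∀ i, ∫⁻ ω, ENNReal.ofReal (Real.exp (ϑ * W i ω)) ∂μ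
      = ∫⁻ ω, ENNReal.ofReal (Real.exp (ϑ * W 0 ω)) ∂μ := fun i =>
    ((hid i).comp hm).lintegral_eq
  have hp := lintegral_prod_eq_prod_lintegral_of_indepFun (μ := μ) (Finset.range N)
    (fun i ω => ENNReal.ofReal (Real.exp (ϑ * W i ω)))
    (hind.comp (fun _ x => ENNReal.ofReal (Real.exp (ϑ * x))) (fun _ => hm))
    (fun i => hm.comp (hW i))
  have e : ∀ ω, ∏ i ∈ Finset.range N, ENNReal.ofReal (Real.exp (ϑ * W i ω))
      = ENNReal.ofReal (Real.exp (ϑ * ∑ i ∈ Finset.range N, W i ω)) := by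
    intro ω
    rw [Finset.mul_sum, Real.exp_sum, ENNReal.ofReal_prod_of_nonneg (fun i _ => (Real.exp_pos _).le)]
  simp only [e, h1, hc, Finset.prod_const, Finset.card_range] at hp
  rw [hc i]
  exact (ENNReal.pow_right_strictMono hN).injective (by simpa using hp.symm)

theorem stationary_workload_logtail_cramer
    {Ω : Type*} [MeasureSpace Ω] [IsProbabilityMeasure (ℙ : Measure Ω)]
    (X : ℝ → Ω → ℝ)
    (hmeas : ∀ t : ℝ, Measurable (X t))
    (hX0 : ∀ᵐ ω ∂ℙ, X 0 ω = 0)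
    (hpath : ∀ᵐ ω ∂ℙ, ∀ t : ℝ, 0 ≤ t →
      ContinuousWithinAt (fun s => X s ω) (Set.Ici t) t ∧
      (0 < t → ∃ l : ℝ, Tendsto (fun s => X s ω) (nhdsWithin t (Set.Iio t)) (nhds l)))
    (hstat : ∀ s t : ℝ, 0 ≤ s → s ≤ t →
      Measure.map (fun ω => X t ω - X s ω) ℙ = Measure.map (X (t - s)) ℙ)
    (hincr : ∀ (n : ℕ) (t : Fin (n + 1) → ℝ), (∀ i, 0 ≤ t i) → StrictMono t →
      iIndepFun
        (fun i : Fin n => fun ω => X (t i.succ) ω - X (t i.castSucc) ω) ℙ)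
    (hint : Integrable (X 1) ℙ)
    (hmean : ∫ ω, X 1 ω ∂ℙ = 0)
    (Qe : Ω → ℝ) (hQe_meas : Measurable Qe)
    (hQe_dist : Measure.map Qe ℙ
      = Measure.map (fun ω => ⨆ r : {r : ℝ // 0 ≤ r}, (X (r : ℝ) ω - (r : ℝ))) ℙ)
    (hQe_indep : IndepFun Qe (fun ω => fun t : ℝ => X t ω) ℙ)
    (φ : ℝ → ℝ) (hφ : ∀ θ : ℝ, φ θ = Real.log (∫ ω, Real.exp (θ * X 1 ω) ∂ℙ))
    (ϑ : ℝ) (hϑ_pos : 0 < ϑ)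
    (hϑ_lt : ∃ β : ℝ, ϑ < β ∧ Integrable (fun ω => Real.exp (β * X 1 ω)) ℙ)
    (hϑ_fix : φ ϑ = ϑ)
    :
    Tendsto (fun u : ℝ => Real.log (ℙ {ω | u < Qe ω}).toReal / u)
      atTop (nhds (-ϑ)) := by
  -- exponential moments
  obtain ⟨β, hβ, hβi⟩ := hϑ_lt
  have hexp : ∫ ω, Real.exp (ϑ * X 1 ω) ∂ℙ = Real.exp ϑ := by
    have h := hφ ϑ
    rw [hϑ_fix] at h
    have h0 : 0 ≤ ∫ ω, Real.exp (ϑ * X 1 ω) ∂ℙ := integral_nonneg (fun ω => (Real.exp_pos _).le)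
    rcases h0.eq_or_lt with h' | h'
    · rw [← h', Real.log_zero] at h; linarith
    · exact (Real.exp_log h').symm.trans (congrArg Real.exp h.symm)
  have hϑi : Integrable (fun ω => Real.exp (ϑ * X 1 ω)) ℙ :=
    integrable_exp_mul_of_nonneg_of_le hβi hϑ_pos.le hβ.le
  -- increments
  let W : ℝ → ℕ → Ω → ℝ := fun h i ω => X (((i + 1 : ℕ) : ℝ) * h) ω - X ((i : ℝ) * h) ω - h
  have hWm : ∀ h i, Measurable (W h i) := fun h i =>
    ((hmeas _).sub (hmeas _)).sub_const h
  have hWind : ∀ h, 0 < h → iIndepFun (W h) ℙ := fun h hh => aux_indep ℙ X hincr h hh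
  have hWX : ∀ h, 0 < h → ∀ i, IdentDistrib (W h i) (fun ω => X h ω - h) ℙ ℙ := by
    intro h hh i
    have h1 : IdentDistrib (fun ω => X (((i + 1 : ℕ) : ℝ) * h) ω - X ((i : ℝ) * h) ω) (X h) ℙ ℙ := by
      refine ⟨((hmeas _).sub (hmeas _)).aemeasurable, (hmeas _).aemeasurable, ?_⟩
      rw [hstat _ _ (by positivity) (by push_cast; nlinarith)]
      congr 2
      push_cast; ring
    exact h1.comp (u := fun x => x - h) (by fun_prop)
  have hWid : ∀ h, 0 < h → ∀ i, IdentDistrib (W h i) (W h 0) ℙ ℙ := fun h hh i =>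
    (hWX h hh i).trans (hWX h hh 0).symm
  have hsum : ∀ h k ω, ∑ i ∈ Finset.range k, W h i ω = X (k * h) ω - X 0 ω - k * h :=
    fun h k ω => aux_sum (fun t => X t ω) h k
  have hlint1 : ∫⁻ ω, ENNReal.ofReal (Real.exp (ϑ * (X 1 ω - X 0 ω - 1))) ∂ℙ = 1 := by
    have e1 : ∫⁻ ω, ENNReal.ofReal (Real.exp (ϑ * (X 1 ω - X 0 ω - 1))) ∂ℙ
        = ∫⁻ ω, ENNReal.ofReal (Real.exp (-ϑ) * Real.exp (ϑ * X 1 ω)) ∂ℙ := by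
      apply lintegral_congr_ae
      filter_upwards [hX0] with ω hω
      rw [hω, ← Real.exp_add]; ring_nf
    rw [e1, ← ofReal_integral_eq_lintegral_ofReal (hϑi.const_mul _)
      (Eventually.of_forall (fun ω => by positivity)), integral_const_mul, hexp, ← Real.exp_add]
    simp
  have hWl : ∀ (j : ℕ) i, ∫⁻ ω, ENNReal.ofReal (Real.exp (ϑ * W (1 / 2 ^ j) i ω)) ∂ℙ = 1 := by
    intro j
    refine aux_lint ℙ _ (hWm _) (hWind _ (by positivity)) (hWid _ (by positivity)) ϑ (2 ^ j)
      (by positivity) ?_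
    have e : (((2 ^ j : ℕ) : ℝ)) * (1 / 2 ^ j) = 1 := by push_cast; field_simp
    simp only [hsum, e]
    exact hlint1
  -- upper bound
  have hupper : ∀ u : ℝ, 0 ≤ u → ℙ {ω | ∃ r : ℝ, 0 ≤ r ∧ u < X r ω - r}
      ≤ ENNReal.ofReal (Real.exp (-(ϑ * u))) := by
    intro u hu
    let A : ℕ → Set Ω := fun j =>
      {ω | ∃ k ≤ 4 ^ j, u < ∑ i ∈ Finset.range k, W (1 / 2 ^ j) i ω}
    have hA : ∀ j, ℙ (A j) ≤ ENNReal.ofReal (Real.exp (-(ϑ * u))) := fun j =>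
      aux_maximal ℙ _ (hWm _) (hWind _ (by positivity)) ϑ hϑ_pos (hWl j) u hu (4 ^ j)
    have hmono : Monotone A := by
      apply monotone_nat_of_le_succ
      rintro j ω ⟨k, hk, h⟩
      refine ⟨2 * k, by rw [pow_succ]; omega, ?_⟩
      rw [hsum] at h ⊢
      have e : ((2 * k : ℕ) : ℝ) * (1 / 2 ^ (j + 1)) = k * (1 / 2 ^ j) := by
        push_cast; rw [pow_succ]; field_simp
      rwa [e]
    have hUn : ℙ (⋃ j, A j) ≤ ENNReal.ofReal (Real.exp (-(ϑ * u))) := by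
      rw [hmono.measure_iUnion]
      exact iSup_le hA
    refine le_trans (measure_mono_ae ?_) hUn
    filter_upwards [hX0, hpath] with ω h0 hp
    rintro ⟨r, hr, hlt⟩
    have hc : Tendsto (fun s => X s ω - s) (nhdsWithin r (Set.Ici r)) (nhds (X r ω - r)) :=
      (hp r hr).1.sub continuousWithinAt_id
    have ht : Tendsto (fun j : ℕ => (⌈r * 2 ^ j⌉₊ : ℝ) * (1 / 2 ^ j)) atTop
        (nhdsWithin r (Set.Ici r)) := by
      rw [tendsto_nhdsWithin_iff]
      have lo : ∀ j : ℕ, r ≤ (⌈r * 2 ^ j⌉₊ : ℝ) * (1 / 2 ^ j) := by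
        intro j
        rw [mul_one_div, le_div_iff₀ (by positivity)]
        exact Nat.le_ceil _
      have hi : ∀ j : ℕ, (⌈r * 2 ^ j⌉₊ : ℝ) * (1 / 2 ^ j) ≤ r + (1 / 2) ^ j := by
        intro j
        have := (Nat.ceil_lt_add_one (show 0 ≤ r * 2 ^ j by positivity)).le
        rw [mul_one_div, div_le_iff₀ (by positivity), add_mul, ← mul_pow]
        norm_num
        exact this
      refine ⟨?_, Eventually.of_forall lo⟩
      refine tendsto_of_tendsto_of_tendsto_of_le_of_le tendsto_const_nhds ?_ lo hi
      have := (tendsto_pow_atTop_nhds_zero_of_lt_one (r := (1/2 : ℝ)) (by norm_num) (by norm_num)).const_add r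
      simpa using this
    have hev := (hc.comp ht).eventually (lt_mem_nhds hlt)
    have hev2 : ∀ᶠ j : ℕ in atTop, r ≤ 2 ^ j :=
      (tendsto_pow_atTop_atTop_of_one_lt (by norm_num : (1:ℝ) < 2)).eventually_ge_atTop r
    obtain ⟨j, hj1, hj2⟩ := (hev.and hev2).exists
    refine mem_iUnion.2 ⟨j, ⌈r * 2 ^ j⌉₊, ?_, ?_⟩
    · apply Nat.ceil_le.2
      push_cast
      have : (4 : ℝ) ^ j = 2 ^ j * 2 ^ j := by rw [← mul_pow]; norm_num
      rw [this]
      gcongr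
    · rw [hsum, h0, sub_zero]
      exact hj1
  -- the supremum
  set F : Ω → ℝ := fun ω => ⨆ r : {r : ℝ // 0 ≤ r}, (X (r : ℝ) ω - (r : ℝ)) with hF
  have hFm : AEMeasurable F ℙ := by
    by_contra hcon
    rw [Measure.map_of_not_aemeasurable hcon] at hQe_dist
    have := Measure.isProbabilityMeasure_map (μ := (ℙ : Measure Ω)) hQe_meas.aemeasurable
    rw [hQe_dist] at this
    exact IsProbabilityMeasure.ne_zero (0 : Measure ℝ) rfl
  have hQF : ∀ u : ℝ, ℙ {ω | u < Qe ω} = ℙ {ω | u < F ω} := by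
    intro u
    have h1 := Measure.map_apply (μ := (ℙ : Measure Ω)) hQe_meas (measurableSet_Ioi (a := u))
    rw [hQe_dist, Measure.map_apply_of_aemeasurable hFm measurableSet_Ioi] at h1
    exact h1.symm
  have : Nonempty {r : ℝ // 0 ≤ r} := ⟨⟨0, le_rfl⟩⟩
  have hbdd : ∀ᵐ ω ∂ℙ, BddAbove (range (fun r : {r : ℝ // 0 ≤ r} => X (r : ℝ) ω - (r : ℝ))) := by
    rw [ae_iff]
    have hle : ∀ n : ℕ, ℙ {ω | ¬ BddAbove (range (fun r : {r : ℝ // 0 ≤ r} => X (r : ℝ) ω - (r : ℝ)))}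
        ≤ ENNReal.ofReal (Real.exp (-(ϑ * n))) := by
      intro n
      refine le_trans (measure_mono ?_) (hupper n (by positivity))
      intro ω hω
      obtain ⟨_, ⟨r, rfl⟩, h⟩ := not_bddAbove_iff.1 hω n
      exact ⟨r, r.2, h⟩
    have ht : Tendsto (fun n : ℕ => ENNReal.ofReal (Real.exp (-(ϑ * n)))) atTop (nhds 0) := by
      rw [← ENNReal.ofReal_zero]
      apply ENNReal.tendsto_ofReal
      apply Real.tendsto_exp_neg_atTop_nhds_zero.comp
      exact tendsto_natCast_atTop_atTop.const_mul_atTop hϑ_pos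
    exact le_antisymm (ge_of_tendsto' ht hle) (zero_le)
  apply aux_limit (fun u => (ℙ {ω | u < Qe ω}).toReal) ϑ hϑ_pos
  · intro u hu
    show (ℙ {ω | u < Qe ω}).toReal ≤ _
    rw [hQF]
    apply ENNReal.toReal_le_of_le_ofReal (Real.exp_pos _).le
    refine le_trans (measure_mono ?_) (hupper u hu)
    intro ω hω
    obtain ⟨r, hr⟩ := exists_lt_of_lt_ciSup (show u < F ω from hω)
    exact ⟨r, r.2, hr⟩
  · intro ε hε hε1
    have i1 := hWX 1 one_pos 0
    have hset : ∀ t, Integrable (fun ω => Real.exp (t * X 1 ω)) ℙ → t ∈ integrableExpSet (W 1 0) ℙ := by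
      intro t ht
      have i2 := i1.comp (u := fun x => Real.exp (t * x)) (by fun_prop)
      refine i2.integrable_iff.2 ?_
      refine (ht.const_mul (Real.exp (-t))).congr (Eventually.of_forall (fun ω => ?_))
      simp only [Function.comp]
      rw [← Real.exp_add]; ring_nf
    have hin : ϑ ∈ interior (integrableExpSet (W 1 0) ℙ) := by
      rw [mem_interior_iff_mem_nhds]
      refine mem_of_superset (Icc_mem_nhds hϑ_pos hβ) ?_
      intro t ht
      exact hset t (integrable_exp_mul_of_nonneg_of_le hβi ht.1 ht.2)
    have hm1 : mgf (W 1 0) ℙ ϑ = 1 := by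
      rw [mgf_congr_of_identDistrib _ _ i1 ϑ, mgf]
      have : ∀ ω, Real.exp (ϑ * (X 1 ω - 1)) = Real.exp (-ϑ) * Real.exp (ϑ * X 1 ω) := by
        intro ω; rw [← Real.exp_add]; ring_nf
      simp only [this]
      rw [integral_const_mul, hexp, ← Real.exp_add]; simp
    have hmn : ∫ ω, W 1 0 ω ∂ℙ ≠ 0 := by
      rw [i1.integral_eq, integral_sub hint (integrable_const _), hmean]
      simp
    have hpos := aux_deriv_pos ℙ (W 1 0) ϑ hϑ_pos hin hm1 hmn
    filter_upwards [aux_lower ℙ (W 1) (hWm 1) (hWind 1 one_pos) (hWid 1 one_pos) ϑ _ hϑ_pos hpos hin hm1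
      (hasDerivAt_mgf hin) ε hε hε1] with u hu
    obtain ⟨n, hn⟩ := hu
    refine le_trans hn ?_
    rw [hQF]
    refine ENNReal.toReal_mono (measure_ne_top _ _) (measure_mono_ae ?_)
    filter_upwards [hX0, hbdd] with ω h0 hb h
    have h : u < ∑ i ∈ Finset.range n, W 1 i ω := h
    rw [hsum, h0] at h
    have := le_ciSup hb ⟨(n : ℝ), by positivity⟩
    show u < F ω
    simp only [mul_one, sub_zero] at h
    exact lt_of_lt_of_le h this
end
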